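/- arXiv:1706.05738 — 2 statements merged into one kernel-verified Lean document; each statement's English description precedes it below -/
import Mathlib

section
/- There is an absolute constant c > 0 such that for every integer n ≥ 2 and every ε ∈ (0,1), the ε-bracketing number of the class LCV_n of discrete log-concave distributions on {0,...,n-1} with respect to Hellinger distance satisfies N_[](ε, LCV_n) ≤ (n/ε)^{c/√ε}. -/
open scoped BigOperators

namespace Stmt17

/-- A (discrete) probability distribution on `α`, given by its probability mass function. -/
def IsDistr {α : Type*} (P : α → ℝ) : Prop :=
  (∀ a, 0 ≤ P a) ∧ HasSum P 1

/-- A distribution `P` on `ℤ` is log-concave if (i) it has no "internal zeros" and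
(ii) `P(j)² ≥ P(j-1)·P(j+1)` for all `j`. -/
def IsLogConcave (P : ℤ → ℝ) : Prop :=
  (∀ i j l : ℤ, i < j → j < l → 0 < P i * P l → 0 < P j) ∧
  (∀ j : ℤ, P (j - 1) * P (j + 1) ≤ P j ^ 2)

/-- The class of discrete log-concave distributions supported on `{0, …, n-1}`. -/
def LCVclass (n : ℕ) : Set (ℤ → ℝ) :=
  { P | IsDistr P ∧ IsLogConcave P ∧ ∀ j : ℤ, (j < 0 ∨ (n : ℤ) ≤ j) → P j = 0 }

/-- A pseudo-distribution on `ℤ`: a nonnegative function with finite sum. -/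
def IsPseudoDistr (g : ℤ → ℝ) : Prop :=
  (∀ j, 0 ≤ g j) ∧ Summable g

/-- Hellinger distance between pseudo-distributions on `ℤ`. -/
noncomputable def hellinger (f g : ℤ → ℝ) : ℝ :=
  Real.sqrt ((1 / 2) * ∑' j : ℤ, (Real.sqrt (f j) - Real.sqrt (g j)) ^ 2)

/-- Nonnegative, nondecreasing and log-concave sequences. -/
structure IncLogConcave (f : ℕ → ℝ) : Prop where
  nonneg : ∀ j, 0 ≤ f j
  mono : Monotone f
  log_concave : ∀ j, f j * f (j + 2) ≤ f (j + 1) ^ 2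

/-- Partial sums `f 0 + … + f j`. -/
noncomputable def cum (f : ℕ → ℝ) (j : ℕ) : ℝ := ∑ i ∈ Finset.range (j + 1), f i

/-- The eighth root of the partial sum. -/
noncomputable def cumRoot (f : ℕ → ℝ) (j : ℕ) : ℝ := (cum f j) ^ (1 / 8 : ℝ)

/-- The increment of `log f`. -/
noncomputable def slope (f : ℕ → ℝ) (j : ℕ) : ℝ := Real.log (f (j + 1)) - Real.log (f j)

/-- A bounded monotone potential whose increments control the decrease of `slope f`. -/
noncomputable def slopePotential (f : ℕ → ℝ) (j : ℕ) : ℝ :=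
  9 * cumRoot f (j + 1) - cumRoot f j ^ 9 / f j * slope f j

lemma cum_succ (f : ℕ → ℝ) (j : ℕ) : cum f (j + 1) = cum f j + f (j + 1) := by
  simp [cum, Finset.sum_range_succ]

namespace IncLogConcave

variable {f : ℕ → ℝ}

lemma cum_nonneg (hf : IncLogConcave f) (j : ℕ) : 0 ≤ cum f j :=
  Finset.sum_nonneg fun i _ => hf.nonneg i

lemma cum_mono (hf : IncLogConcave f) : Monotone (cum f) :=
  monotone_nat_of_le_succ fun j => by rw [cum_succ]; linarith [hf.nonneg (j + 1)]

lemma le_cum (hf : IncLogConcave f) (j : ℕ) : f j ≤ cum f j :=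
  Finset.single_le_sum (f := f) (fun i _ => hf.nonneg i) (by simp)

lemma cum_le (hf : IncLogConcave f) (j : ℕ) : cum f j ≤ (j + 1) * f j := by
  have := Finset.sum_le_card_nsmul (Finset.range (j + 1)) f (f j) fun i hi =>
    hf.mono (by simp at hi; omega)
  simpa [cum] using this

lemma cumRoot_nonneg (hf : IncLogConcave f) (j : ℕ) : 0 ≤ cumRoot f j :=
  Real.rpow_nonneg (hf.cum_nonneg j) _

lemma cumRoot_pow (hf : IncLogConcave f) (j : ℕ) : cumRoot f j ^ 8 = cum f j := by
  rw [cumRoot, ← Real.rpow_natCast, ← Real.rpow_mul (hf.cum_nonneg j)]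
  norm_num

lemma cumRoot_mono (hf : IncLogConcave f) : Monotone (cumRoot f) := fun _ _ h =>
  Real.rpow_le_rpow (hf.cum_nonneg _) (hf.cum_mono h) (by norm_num)

lemma pos_of_le (hf : IncLogConcave f) {a j : ℕ} (ha : 0 < f a) (h : a ≤ j) : 0 < f j :=
  ha.trans_le (hf.mono h)

lemma cum_pos (hf : IncLogConcave f) {j : ℕ} (hj : 0 < f j) : 0 < cum f j :=
  hj.trans_le (hf.le_cum j)

lemma cumRoot_pos (hf : IncLogConcave f) {j : ℕ} (hj : 0 < f j) : 0 < cumRoot f j :=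
  Real.rpow_pos_of_pos (hf.cum_pos hj) _

lemma cumRoot_pow_succ (hf : IncLogConcave f) (j : ℕ) :
    f (j + 1) = cumRoot f (j + 1) ^ 8 - cumRoot f j ^ 8 := by
  rw [hf.cumRoot_pow, hf.cumRoot_pow, cum_succ]; ring

/-- The ratio `f / cum f` is nonincreasing. -/
lemma hazard (hf : IncLogConcave f) (j : ℕ) : f (j + 1) * cum f j ≤ f j * cum f (j + 1) := by
  induction j with
  | zero =>
    have h0 := hf.nonneg 0
    have h1 := hf.nonneg 1
    simp only [cum, zero_add, Finset.sum_range_succ, Finset.sum_range_zero]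
    nlinarith
  | succ j ih =>
    have h0 := hf.nonneg j
    have h1 := hf.nonneg (j + 1)
    have h2 := hf.nonneg (j + 2)
    have key : f (j + 2) * cum f j ≤ f (j + 1) * cum f (j + 1) := by
      rcases h0.eq_or_lt with h | h
      · have hz : cum f j = 0 :=
          le_antisymm ((hf.cum_le j).trans (by rw [← h]; simp)) (hf.cum_nonneg j)
        rw [hz, mul_zero]
        exact mul_nonneg h1 (hf.cum_nonneg _)
      · have e1 := mul_le_mul_of_nonneg_right (hf.log_concave j) (hf.cum_nonneg j)
        have e2 := mul_le_mul_of_nonneg_left ih h1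
        have : f j * (f (j + 2) * cum f j) ≤ f j * (f (j + 1) * cum f (j + 1)) := by nlinarith
        exact le_of_mul_le_mul_left this h
    rw [cum_succ f (j + 1)]
    have := cum_succ f j
    nlinarith

lemma slope_nonneg (hf : IncLogConcave f) {j : ℕ} (hj : 0 < f j) : 0 ≤ slope f j :=
  sub_nonneg.2 (Real.log_le_log hj (hf.mono (Nat.le_succ j)))

lemma slope_succ_le (hf : IncLogConcave f) {j : ℕ} (hj : 0 < f j) :
    slope f (j + 1) ≤ slope f j := by
  have h1 := hf.pos_of_le hj (Nat.le_add_right j 1)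
  have h2 := hf.pos_of_le hj (Nat.le_add_right j 2)
  have := Real.log_le_log (mul_pos hj h2) (hf.log_concave j)
  rw [Real.log_mul hj.ne' h2.ne', Real.log_pow] at this
  simp only [slope]
  push_cast at this
  have e : j + 1 + 1 = j + 2 := rfl
  rw [e]
  linarith

lemma slope_anti (hf : IncLogConcave f) {a i j : ℕ} (ha : 0 < f a) (hai : a ≤ i) (hij : i ≤ j) :
    slope f j ≤ slope f i := by
  induction j, hij using Nat.le_induction with
  | base => exact le_rfl
  | succ j hij ih => exact (hf.slope_succ_le (hf.pos_of_le ha (hai.trans hij))).trans ih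

lemma slope_le (hf : IncLogConcave f) {j : ℕ} (hj : 0 < f j) :
    slope f j ≤ 8 * (cumRoot f (j + 1) / cumRoot f j - 1) := by
  have h1 := hf.pos_of_le hj (Nat.le_add_right j 1)
  have y0 := hf.cumRoot_pos hj
  have y1 := hf.cumRoot_pos h1
  have h := Real.log_le_log (mul_pos h1 (hf.cum_pos hj)) (hf.hazard j)
  rw [Real.log_mul h1.ne' (hf.cum_pos hj).ne', Real.log_mul hj.ne' (hf.cum_pos h1).ne',
    ← hf.cumRoot_pow, ← hf.cumRoot_pow, Real.log_pow, Real.log_pow] at h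
  have h2 := Real.log_le_sub_one_of_pos (div_pos y1 y0)
  rw [Real.log_div y1.ne' y0.ne'] at h2
  simp only [slope]
  push_cast at h
  linarith

lemma weight_succ_le (hf : IncLogConcave f) {j : ℕ} (hj : 0 < f j) :
    cumRoot f j ^ 9 / f j ≤ cumRoot f (j + 1) ^ 9 / f (j + 1) := by
  have h1 := hf.pos_of_le hj (Nat.le_add_right j 1)
  rw [div_le_div_iff₀ hj h1]
  have h := hf.hazard j
  rw [← hf.cumRoot_pow, ← hf.cumRoot_pow] at h
  have y0 := hf.cumRoot_nonneg j
  have hy := hf.cumRoot_mono (Nat.le_add_right j 1)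
  have y1 := hf.cumRoot_nonneg (j + 1)
  calc cumRoot f j ^ 9 * f (j + 1) = cumRoot f j * (f (j + 1) * cumRoot f j ^ 8) := by ring
    _ ≤ cumRoot f (j + 1) * (f j * cumRoot f (j + 1) ^ 8) := by gcongr
    _ = _ := by ring

lemma slopePotential_step (hf : IncLogConcave f) {j : ℕ} (hj : 0 < f j) :
    cumRoot f j ^ 9 / f j * (slope f j - slope f (j + 1)) ≤
      slopePotential f (j + 1) - slopePotential f j := by
  have h1 := hf.pos_of_le hj (Nat.le_add_right j 1)
  have hs := hf.slope_le h1
  have hs0 := hf.slope_nonneg h1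
  have y0 := hf.cumRoot_pos hj
  have y1 := hf.cumRoot_pos h1
  have hy := hf.cumRoot_mono (Nat.le_add_right j 1)
  have key : cumRoot f (j + 1) ^ 9 / f (j + 1) - cumRoot f j ^ 9 / f j ≤
      9 / 8 * cumRoot f (j + 1) := by
    have e1 : cumRoot f j ^ 9 / f (j + 1) ≤ cumRoot f j ^ 9 / f j := by
      gcongr
      exact hf.mono (Nat.le_add_right j 1)
    have e2 : cumRoot f (j + 1) ^ 9 / f (j + 1) - cumRoot f j ^ 9 / f (j + 1) ≤
        9 / 8 * cumRoot f (j + 1) := by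
      rw [← sub_div, div_le_iff₀ h1, hf.cumRoot_pow_succ j]
      have := one_add_mul_le_pow (a := cumRoot f (j + 1) / cumRoot f j - 1)
        (by have := div_pos y1 y0; linarith) 9
      rw [add_sub_cancel, div_pow, le_div_iff₀ (by positivity)] at this
      have e3 : (1 + ((9 : ℕ) : ℝ) * (cumRoot f (j + 1) / cumRoot f j - 1)) * cumRoot f j ^ 9 =
        9 * cumRoot f (j + 1) * cumRoot f j ^ 8 - 8 * cumRoot f j ^ 9 := by
        push_cast; field_simp; ring
      rw [e3] at this
      nlinarith
    linarith
  have h3 : (cumRoot f (j + 1) ^ 9 / f (j + 1) - cumRoot f j ^ 9 / f j) * slope f (j + 1) ≤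
      9 * (cumRoot f (j + 2) - cumRoot f (j + 1)) := by
    calc _ ≤ 9 / 8 * cumRoot f (j + 1) * slope f (j + 1) := by gcongr
      _ ≤ 9 / 8 * cumRoot f (j + 1) * (8 * (cumRoot f (j + 1 + 1) / cumRoot f (j + 1) - 1)) := by
        gcongr
      _ = _ := by field_simp
  simp only [slopePotential]
  have e : j + 1 + 1 = j + 2 := rfl
  rw [e]
  linarith

lemma slopePotential_mem (hf : IncLogConcave f) {j : ℕ} (hj : 0 < f j) :
    0 ≤ slopePotential f j ∧ slopePotential f j ≤ 9 * cumRoot f (j + 1) := by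
  have h1 := hf.pos_of_le hj (Nat.le_add_right j 1)
  have hs := hf.slope_le hj
  have hs0 := hf.slope_nonneg hj
  have y0 := hf.cumRoot_pos hj
  have y1 := hf.cumRoot_pos h1
  have hy := hf.cumRoot_mono (Nat.le_add_right j 1)
  have key : cumRoot f j ^ 9 / f j * slope f j ≤ 8 * cumRoot f (j + 1) := by
    have hz := hf.hazard j
    rw [← hf.cumRoot_pow, ← hf.cumRoot_pow] at hz
    have e1 : cumRoot f j ^ 9 / f j ≤ cumRoot f j * (cumRoot f (j + 1) ^ 8 / f (j + 1)) := by
      rw [mul_div_assoc', div_le_div_iff₀ hj h1]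
      nlinarith
    calc _ ≤ cumRoot f j * (cumRoot f (j + 1) ^ 8 / f (j + 1)) *
          (8 * (cumRoot f (j + 1) / cumRoot f j - 1)) := by gcongr
      _ = 8 * cumRoot f (j + 1) * (cumRoot f (j + 1) ^ 7 *
          (cumRoot f (j + 1) - cumRoot f j) / f (j + 1)) := by field_simp
      _ ≤ 8 * cumRoot f (j + 1) * 1 := by
        gcongr
        rw [div_le_one h1, hf.cumRoot_pow_succ j]
        have : cumRoot f j ^ 7 ≤ cumRoot f (j + 1) ^ 7 := by gcongr
        nlinarith
      _ = _ := by ring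
  have : 0 ≤ cumRoot f j ^ 9 / f j * slope f j := by positivity
  simp only [slopePotential]
  constructor <;> linarith

lemma slopePotential_diff (hf : IncLogConcave f) {a j : ℕ} (ha : 0 < f a) (haj : a ≤ j) :
    cumRoot f a ^ 9 / f a * (slope f a - slope f j) ≤
      slopePotential f j - slopePotential f a ∧
    cumRoot f a ^ 9 / f a ≤ cumRoot f j ^ 9 / f j := by
  induction j, haj using Nat.le_induction with
  | base => simp
  | succ j haj ih =>
    have hj := hf.pos_of_le ha haj
    have h1 := hf.slopePotential_step hj
    have h2 := mul_le_mul_of_nonneg_right ih.2 (sub_nonneg.2 (hf.slope_succ_le hj))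
    exact ⟨by linarith [ih.1], ih.2.trans (hf.weight_succ_le hj)⟩

lemma slopePotential_mono (hf : IncLogConcave f) {a j : ℕ} (ha : 0 < f a) (haj : a ≤ j) :
    slopePotential f a ≤ slopePotential f j := by
  have h := (hf.slopePotential_diff ha haj).1
  have h1 := hf.slope_anti ha le_rfl haj
  have h2 := hf.cumRoot_pos ha
  have : 0 ≤ cumRoot f a ^ 9 / f a * (slope f a - slope f j) :=
    mul_nonneg (by positivity) (sub_nonneg.2 h1)
  linarith

/-- On an interval `[a, b]` whose slopes lie between `slope f b` and `slope f a`, `log f` lies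
between two lines through its value at `a`. -/
lemma log_between (hf : IncLogConcave f) {a j b : ℕ} (ha : 0 < f a) (haj : a ≤ j) (hjb : j ≤ b) :
    Real.log (f a) + slope f b * ((j : ℝ) - a) ≤ Real.log (f j) ∧
      Real.log (f j) ≤ Real.log (f a) + slope f a * ((j : ℝ) - a) := by
  induction j, haj using Nat.le_induction with
  | base => simp
  | succ j haj ih =>
    have h1 := hf.slope_anti ha le_rfl haj
    have h2 := hf.slope_anti ha haj (by omega : j ≤ b)
    have h3 := ih (by omega)
    have h4 : Real.log (f (j + 1)) = Real.log (f j) + slope f j := by simp [slope]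
    rw [h4]
    push_cast
    constructor <;> nlinarith

lemma length_mul_le (hf : IncLogConcave f) {a j : ℕ} (haj : a ≤ j) :
    ((j : ℝ) - a) * f a ≤ cum f j - cum f a := by
  induction j, haj using Nat.le_induction with
  | base => simp
  | succ j haj ih =>
    have := hf.mono (by omega : a ≤ j + 1)
    rw [cum_succ]
    push_cast
    linarith

/-- The two potentials control the oscillation of `log f` around a line. -/
lemma slope_gap_mul_length_le (hf : IncLogConcave f) {a j b : ℕ} {q : ℝ} (hq : 0 < q)
    (ha : 0 < f a) (haj : a ≤ j) (hjb : j ≤ b)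
    (hY : cumRoot f b - cumRoot f a ≤ 1 / q) (hY' : 1 / q ≤ cumRoot f a)
    (hB : slopePotential f b - slopePotential f a ≤ 1 / q) :
    (slope f a - slope f b) * ((j : ℝ) - a) ≤ 4096 / (q ^ 2 * cumRoot f j ^ 2) := by
  have y0 := hf.cumRoot_pos ha
  have hyj := hf.cumRoot_mono haj
  have yj : 0 < cumRoot f j := y0.trans_le hyj
  have hyb := hf.cumRoot_mono hjb
  have hl := hf.length_mul_le haj
  rw [← hf.cumRoot_pow, ← hf.cumRoot_pow] at hl
  have hs := (hf.slopePotential_diff ha (haj.trans hjb)).1.trans hB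
  have hs0 : 0 ≤ slope f a - slope f b := sub_nonneg.2 (hf.slope_anti ha le_rfl (haj.trans hjb))
  set y := cumRoot f a
  set x := cumRoot f j
  have hx : x ≤ 2 * y := by linarith
  have e1 : x ^ 8 - y ^ 8 ≤ 8 * x ^ 7 * (x - y) := by
    have := one_add_mul_le_pow (a := y / x - 1) (by have := div_pos y0 yj; linarith) 8
    rw [add_sub_cancel, div_pow, le_div_iff₀ (by positivity)] at this
    have e3 : (1 + ((8 : ℕ) : ℝ) * (y / x - 1)) * x ^ 8 = 8 * x ^ 7 * y - 7 * x ^ 8 := by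
      push_cast; field_simp; ring
    rw [e3] at this
    nlinarith
  have e2 : ((j : ℝ) - a) * f a ≤ 1024 * y ^ 7 / q := by
    calc _ ≤ 8 * x ^ 7 * (x - y) := hl.trans e1
      _ ≤ 8 * (2 * y) ^ 7 * (1 / q) := by
        gcongr
        linarith
      _ = _ := by ring
  have e4 : (slope f a - slope f b) ≤ f a / (y ^ 9 * q) := by
    rw [le_div_iff₀ (by positivity)]
    rw [div_mul_eq_mul_div, div_le_div_iff₀ ha hq] at hs
    linarith
  have e5 : (j : ℝ) - a ≤ 1024 * y ^ 7 / q / f a := by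
    rw [le_div_iff₀ ha]; exact e2
  calc _ ≤ f a / (y ^ 9 * q) * (1024 * y ^ 7 / q / f a) := by
        gcongr
        rw [sub_nonneg]; exact_mod_cast haj
    _ = 4096 / (q ^ 2 * (2 * y) ^ 2) := by field_simp; norm_num
    _ ≤ _ := by gcongr

/-- The cost of the main pieces is summable against the distribution. -/
lemma sum_div_cumRoot_le (hf : IncLogConcave f) (k : ℕ) :
    ∑ j ∈ Finset.range (k + 1), f j / cumRoot f j ^ 4 ≤ 2 * cumRoot f k ^ 4 := by
  induction k with
  | zero =>
    have : f 0 = cumRoot f 0 ^ 8 := by rw [hf.cumRoot_pow]; simp [cum]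
    have h0 := hf.cumRoot_nonneg 0
    simp only [zero_add, Finset.sum_range_one]
    rw [this]
    rcases h0.eq_or_lt with h | h
    · simp [← h]
    · rw [div_le_iff₀ (by positivity)]
      nlinarith [pow_pos h 8]
  | succ k ih =>
    rw [Finset.sum_range_succ]
    have h0 := hf.cumRoot_nonneg k
    have hy := hf.cumRoot_mono (Nat.le_add_right k 1)
    rcases (h0.trans hy).eq_or_lt with h | h
    · have : cumRoot f k = 0 := le_antisymm (h ▸ hy) h0
      rw [this] at ih
      rw [← h]
      simpa using ih
    · have : f (k + 1) / cumRoot f (k + 1) ^ 4 ≤ 2 * (cumRoot f (k + 1) ^ 4 - cumRoot f k ^ 4) := by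
        rw [div_le_iff₀ (by positivity), hf.cumRoot_pow_succ k]
        nlinarith [sq_nonneg (cumRoot f (k + 1) ^ 4 - cumRoot f k ^ 4)]
      linarith

/-- A nondecreasing log-concave sequence has a geometric majorant of comparable mass. -/
lemma tail_le (hf : IncLogConcave f) {a : ℕ} (ha : 0 < f a) {ρ : ℝ}
    (hρ : ρ = 1 - f a / (2 * cum f a)) {d : ℕ} (hd : d ≤ a) :
    f (a - d) ≤ 2 * f a * ρ ^ d := by
  have hF := hf.cum_pos ha
  have hle := hf.le_cum a
  have hρ1 : ρ < 1 := by
    rw [hρ]; have : 0 < f a / (2 * cum f a) := by positivity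
    linarith
  have hρ0 : 0 < ρ := by
    have : f a / (2 * cum f a) ≤ 1 / 2 := by
      rw [div_le_div_iff₀ (by positivity) (by norm_num)]; linarith
    rw [hρ]; linarith
  have key : ∀ d ≤ a, (1 ≤ d ∧ f (a - d) ≤ f a * ρ ^ d ∧ f (a - d) ≤ ρ * f (a - d + 1)) ∨
      (∀ i ≤ d, f a * ρ ^ i ≤ f (a - i)) := by
    intro d
    induction d with
    | zero => intro _; right; intro i hi; obtain rfl : i = 0 := by omega
              simp
    | succ d ih =>
      intro hd
      obtain ⟨t, rfl⟩ : ∃ t, a = t + d + 1 := ⟨a - (d + 1), by omega⟩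
      have e1 : t + d + 1 - (d + 1) = t := by omega
      have e2 : t + d + 1 - d = t + 1 := by omega
      rw [e1]
      rcases ih (by omega) with ⟨h0, h1, h2⟩ | h
      · rw [e2] at h1 h2
        left
        have h3 : f t ≤ ρ * f (t + 1) := by
          rcases (hf.nonneg (t + 2)).eq_or_lt with h | h
          · have : f t ≤ 0 := h ▸ hf.mono (by omega)
            exact this.trans (mul_nonneg hρ0.le (hf.nonneg _))
          · have h4 := hf.log_concave t
            have h5 := mul_le_mul_of_nonneg_left h2 (hf.nonneg (t + 1))
            have : f t * f (t + 2) ≤ ρ * f (t + 1) * f (t + 2) := by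
              have e : t + 1 + 1 = t + 2 := rfl
              rw [e] at h5
              nlinarith
            exact le_of_mul_le_mul_right this h
        refine ⟨by omega, ?_, h3⟩
        calc f t ≤ ρ * f (t + 1) := h3
          _ ≤ ρ * (f (t + d + 1) * ρ ^ d) := by gcongr
          _ = _ := by ring
      · by_cases hc : f (t + d + 1) * ρ ^ (d + 1) ≤ f t
        · right
          intro i hi
          rcases Nat.lt_or_ge i (d + 1) with hlt | hge
          · exact h i (by omega)
          · obtain rfl : i = d + 1 := by omega
            rwa [e1]
        · left
          push Not at hc
          refine ⟨by omega, hc.le, hc.le.trans ?_⟩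
          have := h d le_rfl
          rw [e2] at this
          calc f (t + d + 1) * ρ ^ (d + 1) = ρ * (f (t + d + 1) * ρ ^ d) := by ring
            _ ≤ _ := by gcongr
  have hpow : 0 < ρ ^ d := pow_pos hρ0 d
  rcases key d hd with ⟨_, h, _⟩ | h
  · nlinarith [mul_pos ha hpow]
  · have hsum : ∑ i ∈ Finset.range d, f a * ρ ^ i ≤ cum f a := by
      calc _ ≤ ∑ i ∈ Finset.range d, f (a - i) :=
            Finset.sum_le_sum fun i hi => h i (Finset.mem_range.1 hi).le
        _ ≤ ∑ i ∈ Finset.range (a + 1), f (a - i) :=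
            Finset.sum_le_sum_of_subset_of_nonneg (Finset.range_mono (by omega))
              fun i _ _ => hf.nonneg _
        _ = cum f a := by
            rw [cum, ← Finset.sum_range_reflect]
            refine Finset.sum_congr rfl fun i hi => ?_
            have := Finset.mem_range.1 hi
            congr 1
            omega
    have hg := mul_neg_geom_sum ρ d
    rw [← Finset.mul_sum] at hsum
    have h1 : 1 - ρ = f a / (2 * cum f a) := by rw [hρ]; ring
    rw [h1, div_mul_eq_mul_div, div_eq_iff (by positivity)] at hg
    have h2 : 1 / 2 ≤ ρ ^ d := by nlinarith
    have := hf.mono (Nat.sub_le a d)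
    nlinarith

end IncLogConcave

lemma exp_le_one_add_two_mul {x : ℝ} (h0 : 0 ≤ x) (h1 : x ≤ 1 / 2) :
    Real.exp x ≤ 1 + 2 * x := by
  have h2 := Real.add_one_le_exp (-x)
  have h3 : Real.exp x * Real.exp (-x) = 1 := by rw [← Real.exp_add]; simp
  have h4 := Real.exp_pos x
  have h5 : Real.exp x * (1 - x) ≤ (1 + 2 * x) * (1 - x) := by nlinarith
  exact le_of_mul_le_mul_right h5 (by linarith)

/-- Rounding the coefficients of the line `α + β t` on `0 ≤ t ≤ n` to integers. -/
lemma round_line {δ n : ℝ} (hδ : 0 < δ) (hn : 0 < n) (α β : ℝ) {t : ℝ} (h0 : 0 ≤ t)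
    (h1 : t ≤ n) :
    (δ * ⌊α / δ⌋ + δ / n * ⌊β * n / δ⌋ * t ≤ α + β * t ∧
      α + β * t - 2 * δ ≤ δ * ⌊α / δ⌋ + δ / n * ⌊β * n / δ⌋ * t) ∧
    (α + β * t ≤ δ * (⌊α / δ⌋ + 1) + δ / n * ⌈β * n / δ⌉ * t ∧
      δ * (⌊α / δ⌋ + 1) + δ / n * ⌈β * n / δ⌉ * t ≤ α + β * t + 2 * δ) := by
  have a1 : δ * ⌊α / δ⌋ ≤ α := by
    have := Int.floor_le (α / δ)
    rw [le_div_iff₀ hδ] at this; linarith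
  have a2 : α ≤ δ * (⌊α / δ⌋ + 1) := by
    have := (Int.lt_floor_add_one (α / δ)).le
    rw [div_le_iff₀ hδ] at this; linarith
  have b1 : δ / n * ⌊β * n / δ⌋ ≤ β := by
    have := Int.floor_le (β * n / δ)
    rw [le_div_iff₀ hδ] at this
    rw [div_mul_eq_mul_div, div_le_iff₀ hn]; linarith
  have b2 : β - δ / n ≤ δ / n * ⌊β * n / δ⌋ := by
    have := (Int.lt_floor_add_one (β * n / δ)).le
    rw [div_le_iff₀ hδ] at this
    rw [sub_le_iff_le_add, div_mul_eq_mul_div, ← add_div, le_div_iff₀ hn]; linarith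
  have b3 : β ≤ δ / n * ⌈β * n / δ⌉ := by
    have := Int.le_ceil (β * n / δ)
    rw [div_le_iff₀ hδ] at this
    rw [div_mul_eq_mul_div, le_div_iff₀ hn]; linarith
  have b4 : δ / n * ⌈β * n / δ⌉ ≤ β + δ / n := by
    have := (Int.ceil_lt_add_one (β * n / δ)).le
    rw [← sub_le_iff_le_add, le_div_iff₀ hδ] at this
    rw [← sub_le_iff_le_add, div_mul_eq_mul_div, ← sub_div, div_le_iff₀ hn]; linarith
  have c : δ / n * t ≤ δ := by
    rw [div_mul_eq_mul_div, div_le_iff₀ hn]; nlinarith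
  refine ⟨⟨?_, ?_⟩, ?_, ?_⟩ <;> nlinarith

lemma abs_floor_le {x N : ℝ} (h : |x| + 1 ≤ N) : |(⌊x⌋ : ℝ)| ≤ N := by
  have h1 := Int.floor_le x
  have h2 := (Int.lt_floor_add_one x).le
  have h3 := abs_le.1 (le_refl |x|)
  rw [abs_le]; constructor <;> linarith

lemma abs_ceil_le {x N : ℝ} (h : |x| + 1 ≤ N) : |(⌈x⌉ : ℝ)| ≤ N := by
  have h1 := Int.le_ceil x
  have h2 := (Int.ceil_lt_add_one x).le
  have h3 := abs_le.1 (le_refl |x|)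
  rw [abs_le]; constructor <;> linarith

lemma abs_div_add_one_le {x δ M N : ℝ} (hδ : 0 < δ) (hx : |x| ≤ M) (hN : M / δ + 1 ≤ N) :
    |x / δ| + 1 ≤ N := by
  rw [abs_div, abs_of_pos hδ]
  have : |x| / δ ≤ M / δ := by gcongr
  linarith

lemma abs_log_le {x c : ℝ} (hc : 0 < c) (h1 : 1 / c ≤ x) (h2 : x ≤ 1) : |Real.log x| ≤ c := by
  have hx : 0 < x := lt_of_lt_of_le (by positivity) h1
  rw [abs_of_nonpos (Real.log_nonpos hx.le h2)]
  have := Real.log_le_log (by positivity) h1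
  rw [one_div, Real.log_inv] at this
  have := Real.log_le_sub_one_of_pos hc
  linarith

/-- A coded geometric majorant of the initial part of a nondecreasing log-concave sequence. -/
lemma IncLogConcave.exists_tail_code {f : ℕ → ℝ} (hf : IncLogConcave f) (hf1 : ∀ j, f j ≤ 1)
    {θ n : ℕ} (hn : 1 ≤ n) (hθ : θ ≤ n) {Q δ N : ℝ} (hQ : 0 < Q) (hQ1 : Q ≤ 1) (hδ : 0 < δ)
    (hδ1 : 4 * δ ≤ 1 / 2) (hcum : ∀ j < θ, cum f j ≤ Q)
    (hN : ((n : ℝ) ^ 2 / Q + 3 * n) / δ + 1 ≤ N) :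
    ∃ u p : ℤ, |(u : ℝ)| ≤ N ∧ |(p : ℝ)| ≤ N ∧
      (∀ j < θ, f j ≤ Real.exp (δ * (u + 1) + δ / n * p * j)) ∧
      ∑ j ∈ Finset.range θ, Real.exp (δ * (u + 1) + δ / n * p * j) ≤ 8 * Q := by
  have hn' : (1 : ℝ) ≤ n := by exact_mod_cast hn
  have hn0 : (0 : ℝ) < n := by linarith
  have hexp : Real.exp (2 * δ) ≤ 2 := by
    have := exp_le_one_add_two_mul (x := 2 * δ) (by linarith) (by linarith)
    linarith
  suffices h : ∃ α β : ℝ, |α| ≤ (n : ℝ) ^ 2 / Q + 3 * n ∧ |β * n| ≤ (n : ℝ) ^ 2 / Q + 3 * n ∧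
      (∀ j < θ, f j ≤ Real.exp (α + β * j)) ∧
      ∑ j ∈ Finset.range θ, Real.exp (α + β * j) ≤ 4 * Q by
    obtain ⟨α, β, h1, h2, h3, h4⟩ := h
    have hr : ∀ j < θ, α + β * j ≤ δ * (⌊α / δ⌋ + 1) + δ / n * ⌈β * n / δ⌉ * (j : ℝ) ∧
      δ * (⌊α / δ⌋ + 1) + δ / n * ⌈β * n / δ⌉ * (j : ℝ) ≤ α + β * j + 2 * δ := fun j hj =>
      (round_line hδ hn0 α β (Nat.cast_nonneg j) (by exact_mod_cast (hj.trans_le hθ).le)).2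
    refine ⟨⌊α / δ⌋, ⌈β * n / δ⌉, abs_floor_le (abs_div_add_one_le hδ h1 hN),
      abs_ceil_le (abs_div_add_one_le hδ h2 hN),
      fun j hj => (h3 j hj).trans (Real.exp_le_exp.2 (hr j hj).1), ?_⟩
    calc _ ≤ ∑ j ∈ Finset.range θ, Real.exp (2 * δ) * Real.exp (α + β * j) := by
          refine Finset.sum_le_sum fun j hj => ?_
          rw [← Real.exp_add]
          exact Real.exp_le_exp.2 (by linarith [(hr j (Finset.mem_range.1 hj)).2])
      _ ≤ 2 * (4 * Q) := by
          rw [← Finset.mul_sum]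
          exact mul_le_mul hexp h4 (Finset.sum_nonneg fun _ _ => (Real.exp_pos _).le) (by norm_num)
      _ = _ := by ring
  have hnQ : (n : ℝ) / Q ≤ (n : ℝ) ^ 2 / Q := by
    gcongr; nlinarith
  have hnQ0 : (0 : ℝ) ≤ (n : ℝ) ^ 2 / Q := by positivity
  have hcase : (∀ j < θ, f j ≤ Q / n) ∨ ∃ a, θ = a + 1 ∧ Q / n ≤ f a := by
    rcases θ with _ | a
    · left; simp
    · rcases le_total (f a) (Q / n) with h | h
      · left; exact fun j hj => (hf.mono (by omega)).trans h
      · exact Or.inr ⟨a, rfl, h⟩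
  rcases hcase with h | ⟨a, rfl, ha⟩
  · refine ⟨Real.log (Q / n), 0, ?_, by simp; positivity, ?_, ?_⟩
    · have h1 : Q / n ≤ 1 := by rw [div_le_one hn0]; linarith
      have := abs_log_le (x := Q / n) (c := n / Q) (by positivity) (by rw [one_div_div]) h1
      linarith
    · intro j hj
      rw [zero_mul, add_zero, Real.exp_log (by positivity)]
      exact h j hj
    · simp only [zero_mul, add_zero]
      rw [Real.exp_log (by positivity), Finset.sum_const, Finset.card_range, nsmul_eq_mul]
      have hθ' : (θ : ℝ) ≤ n := by exact_mod_cast hθ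
      calc (θ : ℝ) * (Q / n) ≤ n * (Q / n) := by gcongr
        _ = Q := by field_simp
        _ ≤ 4 * Q := by linarith
  · have fa : 0 < f a := lt_of_lt_of_le (by positivity) ha
    have hF := hf.cum_pos fa
    have hle := hf.le_cum a
    set ρ := 1 - f a / (2 * cum f a) with hρ
    have hρ1 : ρ < 1 := by
      have : 0 < f a / (2 * cum f a) := by positivity
      linarith
    have hρ2 : 1 / 2 ≤ ρ := by
      have : f a / (2 * cum f a) ≤ 1 / 2 := by
        rw [div_le_div_iff₀ (by positivity) (by norm_num)]; linarith
      linarith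
    have hρ0 : 0 < ρ := by linarith
    have hlog : |Real.log ρ| ≤ 2 := abs_log_le (by norm_num) hρ2 hρ1.le
    have haN : (a : ℝ) ≤ n := by exact_mod_cast (by omega : a ≤ n)
    have hval : ∀ j < a + 1, Real.exp (Real.log (2 * f a) + a * Real.log ρ + -Real.log ρ * j) =
        2 * f a * ρ ^ (a - j) := by
      intro j hj
      have : Real.log (2 * f a) + a * Real.log ρ + -Real.log ρ * j =
          Real.log (2 * f a) + ((a - j : ℕ) : ℝ) * Real.log ρ := by
        rw [Nat.cast_sub (by omega)]; ring
      rw [this, Real.exp_add, Real.exp_log (by positivity), ← Real.log_pow,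
        Real.exp_log (by positivity)]
    refine ⟨Real.log (2 * f a) + a * Real.log ρ, -Real.log ρ, ?_, ?_, ?_, ?_⟩
    · have h1 : |Real.log (f a)| ≤ n / Q :=
        abs_log_le (by positivity) (by rw [one_div_div]; exact ha) (hf1 a)
      have h2 : |Real.log (2 * f a)| ≤ 1 + n / Q := by
        rw [Real.log_mul (by norm_num) fa.ne']
        refine (abs_add_le _ _).trans (add_le_add ?_ h1)
        rw [abs_of_nonneg (Real.log_nonneg (by norm_num))]
        linarith [Real.log_two_lt_d9]
      have h3 : |(a : ℝ) * Real.log ρ| ≤ n * 2 := by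
        rw [abs_mul, abs_of_nonneg (Nat.cast_nonneg a)]
        gcongr
      have := abs_add_le (Real.log (2 * f a)) (a * Real.log ρ)
      linarith
    · rw [abs_mul, abs_neg, abs_of_pos hn0]
      nlinarith
    · intro j hj
      rw [hval j hj]
      have := hf.tail_le fa hρ (d := a - j) (Nat.sub_le _ _)
      rwa [Nat.sub_sub_self (by omega)] at this
    · rw [Finset.sum_congr rfl fun j hj => hval j (Finset.mem_range.1 hj), ← Finset.mul_sum]
      have h1 := Finset.sum_range_reflect (fun i => ρ ^ i) (a + 1)
      simp only [Nat.add_sub_cancel] at h1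
      rw [h1]
      have hg := mul_neg_geom_sum ρ (a + 1)
      have h2 : 1 - ρ = f a / (2 * cum f a) := by rw [hρ]; ring
      have h3 : (0 : ℝ) < ρ ^ (a + 1) := by positivity
      rw [h2, div_mul_eq_mul_div, div_eq_iff (by positivity)] at hg
      have h4 := hcum a (by omega)
      nlinarith

/-- Coded log-linear bounds on an interval on which the potentials vary little. -/
lemma IncLogConcave.exists_main_code {f : ℕ → ℝ} (hf : IncLogConcave f) (hf1 : ∀ j, f j ≤ 1)
    {a b n : ℕ} (hab : a ≤ b) (hb : b ≤ n) (hn : 1 ≤ n) {q Q δ N : ℝ} (hq : 8192 ≤ q) (hQ : 0 < Q)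
    (hδ : 0 < δ) (hδ1 : 4 * δ ≤ 1 / 2) (ha : Q / n ≤ f a)
    (hY : cumRoot f b - cumRoot f a ≤ 1 / q) (hY' : 1 / q ≤ cumRoot f a ^ 2)
    (hB : slopePotential f b - slopePotential f a ≤ 1 / q)
    (hN : ((n : ℝ) ^ 2 / Q + 3 * n) / δ + 1 ≤ N) :
    ∃ u p p' : ℤ, |(u : ℝ)| ≤ N ∧ |(p : ℝ)| ≤ N ∧ |(p' : ℝ)| ≤ N ∧ ∀ j : ℕ, a ≤ j → j ≤ b →
      Real.exp (δ * u + δ / n * p * ((j : ℝ) - a)) ≤ f j ∧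
      f j ≤ Real.exp (δ * (u + 1) + δ / n * p' * ((j : ℝ) - a)) ∧
      (Real.sqrt (Real.exp (δ * (u + 1) + δ / n * p' * ((j : ℝ) - a))) -
        Real.sqrt (Real.exp (δ * u + δ / n * p * ((j : ℝ) - a)))) ^ 2 ≤
        f j * (4 * δ + 4096 / (q ^ 2 * cumRoot f j ^ 2)) ^ 2 := by
  have hn' : (1 : ℝ) ≤ n := by exact_mod_cast hn
  have hn0 : (0 : ℝ) < n := by linarith
  have hq0 : 0 < q := by linarith
  have fa : 0 < f a := lt_of_lt_of_le (by positivity) ha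
  have fb := hf.pos_of_le fa hab
  have y0 := hf.cumRoot_pos fa
  have hnQ0 : (0 : ℝ) ≤ (n : ℝ) ^ 2 / Q := by positivity
  have hnQ : (n : ℝ) / Q ≤ (n : ℝ) ^ 2 / Q := by
    gcongr; nlinarith
  have hlog : ∀ j, a ≤ j → |Real.log (f j)| ≤ n / Q := fun j hj =>
    abs_log_le (by positivity) (by rw [one_div_div]; exact ha.trans (hf.mono hj)) (hf1 j)
  have hslope : ∀ j, a ≤ j → |slope f j * n| ≤ (n : ℝ) ^ 2 / Q + 3 * n := by
    intro j hj
    have fj := hf.pos_of_le fa hj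
    have h0 := hf.slope_nonneg fj
    have h1 := (abs_le.1 (hlog j hj)).1
    have h2 := Real.log_nonpos (hf.nonneg (j + 1)) (hf1 (j + 1))
    have h3 : slope f j ≤ n / Q := by simp only [slope]; linarith
    rw [abs_of_nonneg (by positivity)]
    calc slope f j * n ≤ n / Q * n := by gcongr
      _ = (n : ℝ) ^ 2 / Q := by ring
      _ ≤ _ := by linarith
  have hYq : 1 / q ≤ cumRoot f a := by
    have : (1 / q) ^ 2 ≤ cumRoot f a ^ 2 := by
      refine le_trans ?_ hY'
      have : 1 / q ≤ 1 := by rw [div_le_one hq0]; linarith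
      have : 0 < 1 / q := by positivity
      nlinarith
    exact le_of_sq_le_sq this y0.le
  refine ⟨⌊Real.log (f a) / δ⌋, ⌊slope f b * n / δ⌋, ⌈slope f a * n / δ⌉,
    abs_floor_le (abs_div_add_one_le hδ ((hlog a le_rfl).trans (by linarith)) hN),
    abs_floor_le (abs_div_add_one_le hδ (hslope b hab) hN),
    abs_ceil_le (abs_div_add_one_le hδ (hslope a le_rfl) hN), fun j haj hjb => ?_⟩
  have fj := hf.pos_of_le fa haj
  have ht0 : (0 : ℝ) ≤ (j : ℝ) - a := sub_nonneg.2 (by exact_mod_cast haj)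
  have ht1 : (j : ℝ) - a ≤ n := by
    have : (j : ℝ) ≤ n := by exact_mod_cast hjb.trans hb
    linarith [Nat.cast_nonneg (α := ℝ) a]
  have hlow := (round_line hδ hn0 (Real.log (f a)) (slope f b) ht0 ht1).1
  have hup := (round_line hδ hn0 (Real.log (f a)) (slope f a) ht0 ht1).2
  have hbt := hf.log_between fa haj hjb
  have hgap := hf.slope_gap_mul_length_le hq0 fa haj hjb hY hYq hB
  set xL := δ * ⌊Real.log (f a) / δ⌋ + δ / n * ⌊slope f b * n / δ⌋ * ((j : ℝ) - a)
  set xU := δ * (⌊Real.log (f a) / δ⌋ + 1) + δ / n * ⌈slope f a * n / δ⌉ * ((j : ℝ) - a)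
  have hLf : Real.exp xL ≤ f j := by
    rw [← Real.exp_log fj]; exact Real.exp_le_exp.2 (hlow.1.trans hbt.1)
  have hfU : f j ≤ Real.exp xU := by
    rw [← Real.exp_log fj]; exact Real.exp_le_exp.2 (hbt.2.trans hup.1)
  refine ⟨hLf, hfU, ?_⟩
  set η := 4096 / (q ^ 2 * cumRoot f j ^ 2)
  have hη : η ≤ 1 / 2 := by
    have : 1 / q ≤ cumRoot f j ^ 2 :=
      hY'.trans (pow_le_pow_left₀ y0.le (hf.cumRoot_mono haj) 2)
    have yj := hf.cumRoot_pos fj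
    rw [div_le_iff₀ (by positivity)]
    have h2 : q ^ 2 * (1 / q) ≤ q ^ 2 * cumRoot f j ^ 2 := by gcongr
    have h3 : q ^ 2 * (1 / q) = q := by field_simp
    linarith
  have hx1 : xU - xL ≤ 4 * δ + η := by linarith
  have hx0 : 0 ≤ xU - xL := by
    have := Real.exp_le_exp.1 (hLf.trans hfU); linarith
  rw [← Real.exp_half, ← Real.exp_half]
  have e1 : Real.exp (xU / 2) = Real.exp (xL / 2) * Real.exp ((xU - xL) / 2) := by
    rw [← Real.exp_add]; congr 1; ring
  have e2 := exp_le_one_add_two_mul (x := (xU - xL) / 2) (by linarith) (by linarith)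
  have e3 := Real.add_one_le_exp ((xU - xL) / 2)
  have e4 : Real.exp (xL / 2) ^ 2 = Real.exp xL := by
    rw [← Real.exp_nat_mul]; congr 1; push_cast; ring
  calc (Real.exp (xU / 2) - Real.exp (xL / 2)) ^ 2
      = Real.exp xL * (Real.exp ((xU - xL) / 2) - 1) ^ 2 := by rw [e1, ← e4]; ring
    _ ≤ f j * (4 * δ + η) ^ 2 := by
      gcongr
      · linarith
      · linarith

/-- The piecewise log-linear lower bracket with integer code `c`: on the `r`-th piece
`[c 0 r, c 1 r)` with `r ≠ 0` it is a rounded line in logarithmic scale, and zero elsewhere. -/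
noncomputable def codeLower (δ : ℝ) (n : ℕ) {m : ℕ} (c : Fin 5 → Fin m → ℤ) (j : ℤ) : ℝ :=
  ∑ r : Fin m, if c 0 r ≤ j ∧ j < c 1 r ∧ (r : ℕ) ≠ 0 then
    Real.exp (δ * c 2 r + δ / n * c 3 r * ((j : ℝ) - c 0 r)) else 0

/-- The piecewise log-linear upper bracket with integer code `c`. -/
noncomputable def codeUpper (δ : ℝ) (n : ℕ) {m : ℕ} (c : Fin 5 → Fin m → ℤ) (j : ℤ) : ℝ :=
  ∑ r : Fin m, if c 0 r ≤ j ∧ j < c 1 r then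
    Real.exp (δ * (c 2 r + 1) + δ / n * c 4 r * ((j : ℝ) - c 0 r)) else 0

lemma lt_add_one_of_floor_eq {x y : ℝ} (hx : 0 ≤ x) (h : ⌊x⌋₊ = ⌊y⌋₊) : y < x + 1 := by
  have h1 := Nat.lt_floor_add_one y
  have h2 := Nat.floor_le hx
  rw [← h] at h1
  linarith

/-- Index of the piece containing `j`: zero on the tail, increasing with both potentials. -/
noncomputable def pieceIndex (f : ℕ → ℝ) (k q : ℕ) (j : ℕ) : ℕ :=
  if k ≤ j then 20 * q + 1
  else if cum f j ≤ 1 / (q : ℝ) ^ 4 then 0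
  else 1 + ⌊(q : ℝ) * cumRoot f j⌋₊ + ⌊(q : ℝ) * slopePotential f j⌋₊

namespace IncLogConcave

variable {f : ℕ → ℝ}

lemma pos_of_cum_pos (hf : IncLogConcave f) {j : ℕ} (h : 0 < cum f j) : 0 < f j := by
  have := hf.cum_le j
  by_contra! hc
  nlinarith [(Nat.cast_nonneg j : (0 : ℝ) ≤ j)]

lemma cum_le_one (hf : IncLogConcave f) {k j : ℕ} (hsum : ∑ j ∈ Finset.range k, f j ≤ 1)
    (hj : j < k) : cum f j ≤ 1 :=
  (Finset.sum_le_sum_of_subset_of_nonneg (Finset.range_mono hj) fun i _ _ => hf.nonneg i).trans hsum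

lemma pieceIndex_lt_iff (hf : IncLogConcave f) (hf1 : ∀ j, f j ≤ 1) {k q j : ℕ} (hq : 1 ≤ q)
    (hsum : ∑ j ∈ Finset.range k, f j ≤ 1) : pieceIndex f k q j < 20 * q + 1 ↔ j < k := by
  rw [pieceIndex]
  split_ifs with h h'
  · simp; omega
  · simp; omega
  · refine iff_of_true ?_ (by omega)
    have hq0 : (0 : ℝ) < q := by exact_mod_cast hq
    have hc : 0 < cum f j := lt_of_le_of_lt (by positivity) (not_le.1 h')
    have hp := (hf.slopePotential_mem (hf.pos_of_cum_pos hc)).2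
    have h1 := hf.cum_le_one hsum (not_le.1 h)
    have h2 : cumRoot f j ≤ 1 := by
      rw [← pow_le_one_iff_of_nonneg (hf.cumRoot_nonneg j) (by norm_num : 8 ≠ 0), hf.cumRoot_pow]
      exact h1
    have h3 : cumRoot f (j + 1) ≤ 2 := by
      refine le_of_pow_le_pow_left₀ (by norm_num : 8 ≠ 0) (by norm_num) ?_
      rw [hf.cumRoot_pow, cum_succ]
      linarith [hf1 (j + 1)]
    have h4 : ⌊(q : ℝ) * cumRoot f j⌋₊ ≤ q :=
      Nat.floor_le_of_le (by nlinarith)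
    have h5 : ⌊(q : ℝ) * slopePotential f j⌋₊ ≤ 18 * q :=
      Nat.floor_le_of_le (by push_cast; nlinarith)
    omega

lemma pieceIndex_mono (hf : IncLogConcave f) (hf1 : ∀ j, f j ≤ 1) {k q : ℕ} (hq : 1 ≤ q)
    (hsum : ∑ j ∈ Finset.range k, f j ≤ 1) : Monotone (pieceIndex f k q) := by
  intro i j hij
  by_cases hj : k ≤ j
  · by_cases hi : k ≤ i
    · simp [pieceIndex, hi, hj]
    · have := (hf.pieceIndex_lt_iff hf1 hq hsum).2 (not_le.1 hi)
      have e : pieceIndex f k q j = 20 * q + 1 := by simp [pieceIndex, hj]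
      omega
  · have hi : ¬ k ≤ i := by omega
    simp only [pieceIndex, hi, hj, if_false]
    split_ifs with h1 h2 h2
    · exact le_rfl
    · exact Nat.zero_le _
    · exact absurd ((hf.cum_mono hij).trans h2) h1
    · have hc : 0 < cum f i := lt_of_le_of_lt (by positivity) (not_le.1 h1)
      have e1 := hf.cumRoot_mono hij
      have e2 := hf.slopePotential_mono (hf.pos_of_cum_pos hc) hij
      gcongr

lemma variation_le_of_pieceIndex_eq (hf : IncLogConcave f) {k q a b : ℕ} (hq : 1 ≤ q)
    (hab : a ≤ b) (hb : b < k) (h0 : pieceIndex f k q a ≠ 0)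
    (h : pieceIndex f k q a = pieceIndex f k q b) :
    1 / (q : ℝ) ^ 4 < cum f a ∧ cumRoot f b - cumRoot f a ≤ 1 / q ∧
      slopePotential f b - slopePotential f a ≤ 1 / q := by
  have hq0 : (0 : ℝ) < q := by exact_mod_cast hq
  have ha' : ¬ k ≤ a := by omega
  have hb' : ¬ k ≤ b := by omega
  have hca : ¬ cum f a ≤ 1 / (q : ℝ) ^ 4 := fun hc =>
    h0 (by simp only [pieceIndex, ha', hc, if_true, if_false])
  have hcb : ¬ cum f b ≤ 1 / (q : ℝ) ^ 4 := fun hc => hca ((hf.cum_mono hab).trans hc)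
  have hc : 0 < cum f a := lt_of_le_of_lt (by positivity) (not_le.1 hca)
  have fa := hf.pos_of_cum_pos hc
  simp only [pieceIndex, ha', hb', hca, hcb, if_false] at h
  have e1 : (q : ℝ) * cumRoot f a ≤ q * cumRoot f b := by gcongr; exact hf.cumRoot_mono hab
  have e2 : (q : ℝ) * slopePotential f a ≤ q * slopePotential f b := by
    gcongr; exact hf.slopePotential_mono fa hab
  have e3 := Nat.floor_mono e1
  have e4 := Nat.floor_mono e2
  have e5 := lt_add_one_of_floor_eq (mul_nonneg hq0.le (hf.cumRoot_nonneg a))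
    (by omega : ⌊(q : ℝ) * cumRoot f a⌋₊ = ⌊(q : ℝ) * cumRoot f b⌋₊)
  have e6 := lt_add_one_of_floor_eq (mul_nonneg hq0.le (hf.slopePotential_mem fa).1)
    (by omega : ⌊(q : ℝ) * slopePotential f a⌋₊ = ⌊(q : ℝ) * slopePotential f b⌋₊)
  refine ⟨not_le.1 hca, ?_, ?_⟩ <;> rw [le_div_iff₀ hq0] <;> linarith

/-- Coded brackets for the restriction of a nondecreasing log-concave sequence to `[0, k)`. -/
theorem exists_code (hf : IncLogConcave f) (hf1 : ∀ j, f j ≤ 1) {k n q : ℕ} (hn : 1 ≤ n)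
    (hk : k ≤ n) (hq : 8192 ≤ q) (hsum : ∑ j ∈ Finset.range k, f j ≤ 1) {δ N : ℝ} (hδ : 0 < δ)
    (hδ1 : 4 * δ ≤ 1 / 2) (hN : ((n : ℝ) ^ 2 * (q : ℝ) ^ 4 + 3 * n) / δ + 1 ≤ N)
    (hnN : (n : ℝ) ≤ N) :
    ∃ c : Fin 5 → Fin (20 * q + 1) → ℤ, (∀ i r, |(c i r : ℝ)| ≤ N) ∧
      (∀ j < k, codeLower δ n c j ≤ f j ∧ f j ≤ codeUpper δ n c j) ∧
      (∀ j : ℤ, j < 0 ∨ (k : ℤ) ≤ j → codeLower δ n c j = 0 ∧ codeUpper δ n c j = 0) ∧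
      ∑ j ∈ Finset.range k, (Real.sqrt (codeUpper δ n c j) - Real.sqrt (codeLower δ n c j)) ^ 2 ≤
        32 * δ ^ 2 + 2 ^ 27 / (q : ℝ) ^ 4 := by
  have hq1 : 1 ≤ q := by omega
  have hqR : (8192 : ℝ) ≤ q := by exact_mod_cast hq
  have hq0 : (0 : ℝ) < q := by linarith
  have hn0 : (0 : ℝ) < n := by exact_mod_cast hn
  have hQ : (0 : ℝ) < 1 / (q : ℝ) ^ 4 := by positivity
  have hQ1 : 1 / (q : ℝ) ^ 4 ≤ 1 := by
    rw [div_le_one (by positivity)]; exact one_le_pow₀ (by linarith)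
  have hN' : ((n : ℝ) ^ 2 / (1 / (q : ℝ) ^ 4) + 3 * n) / δ + 1 ≤ N := by
    rwa [div_div_eq_mul_div, div_one]
  have hN0 : 0 ≤ N := hn0.le.trans hnN
  set G := pieceIndex f k q with hG
  have Gmono : Monotone G := hf.pieceIndex_mono hf1 hq1 hsum
  have Glt : ∀ j, G j < 20 * q + 1 ↔ j < k := fun j => hf.pieceIndex_lt_iff hf1 hq1 hsum
  have Gk : G k = 20 * q + 1 := by simp [hG, pieceIndex]
  have hex : ∀ r ≤ 20 * q + 1, r ≤ G k := fun r hr => Gk ▸ hr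
  obtain ⟨st, hst, hst'⟩ : ∃ st : ℕ → ℕ, (∀ r ≤ 20 * q + 1, ∀ j, st r ≤ j ↔ r ≤ G j) ∧
      ∀ r ≤ 20 * q + 1, st r ≤ k := by
    have h : ∀ r ≤ 20 * q + 1, ∀ j, sInf {j | r ≤ G j} ≤ j ↔ r ≤ G j := fun r hr j =>
      ⟨fun hj => (Nat.sInf_mem (s := {j | r ≤ G j}) ⟨k, hex r hr⟩ : _ ≤ _).trans (Gmono hj),
        fun hj => Nat.sInf_le hj⟩
    exact ⟨fun r => sInf {j | r ≤ G j}, h, fun r hr => (h r hr k).2 (hex r hr)⟩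
  have hpiece : ∀ r < 20 * q + 1, ∀ j, (st r ≤ j ∧ j < st (r + 1)) ↔ G j = r := by
    intro r hr j
    rw [← not_le, hst r hr.le, hst (r + 1) hr]
    omega
  -- the coefficients on each piece
  have hcoef : ∀ r : Fin (20 * q + 1), ∃ u p p' : ℤ,
      |(u : ℝ)| ≤ N ∧ |(p : ℝ)| ≤ N ∧ |(p' : ℝ)| ≤ N ∧
      (∀ j : ℕ, G j = r → f j ≤ Real.exp (δ * (u + 1) + δ / n * p' * ((j : ℝ) - st r))) ∧
      ((r : ℕ) = 0 → ∑ j ∈ Finset.range (st 1),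
        Real.exp (δ * (u + 1) + δ / n * p' * ((j : ℝ) - st r)) ≤ 8 * (1 / (q : ℝ) ^ 4)) ∧
      ((r : ℕ) ≠ 0 → ∀ j : ℕ, G j = r →
        Real.exp (δ * u + δ / n * p * ((j : ℝ) - st r)) ≤ f j ∧
        (Real.sqrt (Real.exp (δ * (u + 1) + δ / n * p' * ((j : ℝ) - st r))) -
          Real.sqrt (Real.exp (δ * u + δ / n * p * ((j : ℝ) - st r)))) ^ 2 ≤
          f j * (4 * δ + 4096 / ((q : ℝ) ^ 2 * cumRoot f j ^ 2)) ^ 2) := by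
    rintro ⟨r, hr⟩
    simp only
    rcases Nat.eq_zero_or_pos r with rfl | hr0
    · have h0 : st 0 = 0 := Nat.le_zero.1 ((hst 0 (by omega) 0).2 (Nat.zero_le _))
      have h1 : ∀ j, j < st 1 ↔ G j = 0 := fun j => by
        rw [← hpiece 0 (by omega) j, h0]; simp
      obtain ⟨u, p', hu, hp', hb, hs⟩ := hf.exists_tail_code hf1 hn ((hst' 1 (by omega)).trans hk)
        hQ hQ1 hδ hδ1 (fun j hj => by
          have e := (h1 j).1 hj
          have hjk : ¬ k ≤ j := not_le.2 ((Glt j).1 (by omega))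
          by_contra hc
          simp only [hG, pieceIndex, hjk, hc, if_false] at e
          omega) hN'
      refine ⟨u, 0, p', hu, by simpa using hN0, hp', ?_, ?_, by simp⟩
      · intro j hj
        simpa [h0] using hb j ((h1 j).2 hj)
      · intro _
        simpa [h0] using hs
    · by_cases hne : ∃ j, G j = r
      · obtain ⟨i, hi⟩ := hne
        obtain ⟨hi1, hi2⟩ := (hpiece r hr i).2 hi
        have hGa : G (st r) = r := (hpiece r hr _).1 ⟨le_rfl, by omega⟩
        have hGb : G (st (r + 1) - 1) = r := (hpiece r hr _).1 ⟨by omega, by omega⟩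
        have hbk : st (r + 1) - 1 < k := (Glt _).1 (by omega)
        obtain ⟨hc, hY, hB⟩ := hf.variation_le_of_pieceIndex_eq (k := k) (q := q) hq1
          (by omega : st r ≤ st (r + 1) - 1) hbk
          (by rw [← hG, hGa]; omega) (by rw [← hG, hGa, hGb])
        have hcn := hf.cum_le (st r)
        have h1 : ((st r : ℕ) : ℝ) + 1 ≤ n := by exact_mod_cast (by omega : st r + 1 ≤ n)
        have ha : 1 / (q : ℝ) ^ 4 / n ≤ f (st r) := by
          rw [div_le_iff₀ hn0]
          nlinarith [hf.nonneg (st r)]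
        have hY' : 1 / (q : ℝ) ≤ cumRoot f (st r) ^ 2 := by
          refine le_of_pow_le_pow_left₀ (by norm_num : 4 ≠ 0) (by positivity) ?_
          rw [← pow_mul, hf.cumRoot_pow, one_div_pow]
          exact hc.le
        obtain ⟨u, p, p', hu, hp, hp', h⟩ := hf.exists_main_code hf1
          (by omega : st r ≤ st (r + 1) - 1) (by omega) hn hqR hQ hδ hδ1 ha hY hY' hB hN'
        have hj : ∀ j, G j = r → st r ≤ j ∧ j ≤ st (r + 1) - 1 := fun j hj => by
          have := (hpiece r hr j).2 hj
          omega
        exact ⟨u, p, p', hu, hp, hp', fun j h' => (h j (hj j h').1 (hj j h').2).2.1,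
          fun h' => absurd h' (by omega), fun _ j h' =>
            have h'' := h j (hj j h').1 (hj j h').2
            ⟨h''.1, h''.2.2⟩⟩
      · push Not at hne
        exact ⟨0, 0, 0, by simpa using hN0, by simpa using hN0, by simpa using hN0,
          fun j hj => absurd hj (hne j), fun h' => absurd h' (by omega),
          fun _ j hj => absurd hj (hne j)⟩
  choose u p p' hu hp hp' hup htail hmain using hcoef
  let c : Fin 5 → Fin (20 * q + 1) → ℤ :=
    ![fun r => st r, fun r => st (r + 1), u, p, p']
  have hidx : ∀ (j : ℕ) (r : Fin (20 * q + 1)),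
      (c 0 r ≤ (j : ℤ) ∧ (j : ℤ) < c 1 r) ↔ G j = r := fun j r => by
    rw [← hpiece r r.2 j]
    simp [c]
  have hU : ∀ (j : ℕ) (r : Fin (20 * q + 1)), G j = r →
      codeUpper δ n c j = Real.exp (δ * (u r + 1) + δ / n * p' r * ((j : ℝ) - st r)) := by
    intro j r hr
    rw [codeUpper, Finset.sum_eq_single r, if_pos ((hidx j r).2 hr)]
    · simp [c]
    · intro s _ hs
      rw [if_neg]
      rw [hidx j s, hr]
      exact fun h => hs (Fin.ext h.symm)
    · simp
  have hL : ∀ (j : ℕ) (r : Fin (20 * q + 1)), G j = r → codeLower δ n c j =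
      if (r : ℕ) = 0 then 0 else Real.exp (δ * u r + δ / n * p r * ((j : ℝ) - st r)) := by
    intro j r hr
    rw [codeLower, Finset.sum_eq_single r]
    · have := (hidx j r).2 hr
      by_cases h0 : (r : ℕ) = 0
      · simp [h0]
      · rw [if_pos ⟨this.1, this.2, h0⟩, if_neg h0]
        simp [c]
    · intro s _ hs
      rw [if_neg]
      rw [← and_assoc, hidx j s, hr]
      exact fun h => hs (Fin.ext h.1.symm)
    · simp
  refine ⟨c, ?_, ?_, ?_, ?_⟩
  · have hstN : ∀ r ≤ 20 * q + 1, |((st r : ℤ) : ℝ)| ≤ N := fun r hr => by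
      have : (st r : ℝ) ≤ n := by exact_mod_cast (hst' r hr).trans hk
      rw [Int.cast_natCast, abs_of_nonneg (Nat.cast_nonneg _)]
      linarith
    intro i r
    fin_cases i
    · exact hstN r r.2.le
    · exact hstN (r + 1) r.2
    · exact hu r
    · exact hp r
    · exact hp' r
  · intro j hj
    have hr := (Glt j).2 hj
    rw [hU j ⟨G j, hr⟩ rfl, hL j ⟨G j, hr⟩ rfl]
    refine ⟨?_, hup ⟨G j, hr⟩ j rfl⟩
    split_ifs with h
    · exact hf.nonneg j
    · exact (hmain ⟨G j, hr⟩ h j rfl).1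
  · intro j hj
    have hout : ∀ r : Fin (20 * q + 1), ¬ (c 0 r ≤ j ∧ j < c 1 r) := by
      rintro r ⟨h1, h2⟩
      have e1 : c 0 r = st r := rfl
      have e2 : c 1 r = st (r + 1) := rfl
      have := hst' (r + 1) r.2
      omega
    constructor
    · exact Finset.sum_eq_zero fun r _ => if_neg fun h => hout r ⟨h.1, h.2.1⟩
    · exact Finset.sum_eq_zero fun r _ => if_neg (hout r)
  · have hcost : ∀ j ∈ Finset.range k,
        (Real.sqrt (codeUpper δ n c j) - Real.sqrt (codeLower δ n c j)) ^ 2 ≤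
        (if j < st 1 then
          Real.exp (δ * (u 0 + 1) + δ / n * p' 0 * ((j : ℝ) - st (0 : Fin (20 * q + 1)))) else 0) +
        (32 * δ ^ 2 * f j + 2 ^ 25 / (q : ℝ) ^ 4 * (f j / cumRoot f j ^ 4)) := by
      intro j hj
      have hr := (Glt j).2 (Finset.mem_range.1 hj)
      have hnn : 0 ≤ 32 * δ ^ 2 * f j + 2 ^ 25 / (q : ℝ) ^ 4 * (f j / cumRoot f j ^ 4) := by
        have := hf.nonneg j
        have := hf.cumRoot_nonneg j
        positivity
      by_cases h0 : G j = 0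
      · have hj1 : j < st 1 := ((hpiece 0 (by omega) j).2 h0).2
        rw [hU j 0 (by simpa using h0), hL j 0 (by simpa using h0), if_pos hj1]
        simp only [Fin.val_zero, if_true, Real.sqrt_zero, sub_zero]
        rw [Real.sq_sqrt (Real.exp_pos _).le]
        linarith
      · have hj1 : ¬ j < st 1 := fun h => h0 ((hpiece 0 (by omega) j).1
          ⟨(hst 0 (by omega) j).2 (Nat.zero_le _), h⟩)
        rw [hU j ⟨G j, hr⟩ rfl, hL j ⟨G j, hr⟩ rfl, if_neg h0, if_neg hj1, zero_add]
        refine (hmain ⟨G j, hr⟩ h0 j rfl).2.trans ?_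
        have e : 32 * δ ^ 2 * f j + 2 ^ 25 / (q : ℝ) ^ 4 * (f j / cumRoot f j ^ 4) =
            f j * (2 * ((4 * δ) ^ 2 + (4096 / ((q : ℝ) ^ 2 * cumRoot f j ^ 2)) ^ 2)) := by
          have e' : ((q : ℝ) ^ 2 * cumRoot f j ^ 2) ^ 2 = (q : ℝ) ^ 4 * cumRoot f j ^ 4 := by ring
          rw [div_pow, e']
          ring
        rw [e]
        exact mul_le_mul_of_nonneg_left add_sq_le (hf.nonneg j)
    refine (Finset.sum_le_sum hcost).trans ?_
    rw [Finset.sum_add_distrib, Finset.sum_add_distrib, ← Finset.mul_sum, ← Finset.mul_sum]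
    have h1 : ∑ j ∈ Finset.range k, (if j < st 1 then
        Real.exp (δ * (u 0 + 1) + δ / n * p' 0 * ((j : ℝ) - st (0 : Fin (20 * q + 1)))) else 0) ≤
        8 * (1 / (q : ℝ) ^ 4) := by
      rw [← Finset.sum_filter]
      refine le_trans (le_of_eq ?_) (htail 0 rfl)
      refine Finset.sum_congr ?_ fun _ _ => rfl
      ext j
      have := hst' 1 (by omega)
      simp
      omega
    have h2 : ∑ j ∈ Finset.range k, f j / cumRoot f j ^ 4 ≤ 2 := by
      rcases k with _ | k
      · simp
      · refine (hf.sum_div_cumRoot_le k).trans ?_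
        have h3 : cumRoot f k ≤ 1 := by
          rw [← pow_le_one_iff_of_nonneg (hf.cumRoot_nonneg k) (by norm_num : 8 ≠ 0),
            hf.cumRoot_pow]
          exact hsum
        have := pow_le_one₀ (n := 4) (hf.cumRoot_nonneg k) h3
        linarith
    have h3 : 32 * δ ^ 2 * ∑ j ∈ Finset.range k, f j ≤ 32 * δ ^ 2 * 1 := by gcongr
    have h4 : 2 ^ 25 / (q : ℝ) ^ 4 * ∑ j ∈ Finset.range k, f j / cumRoot f j ^ 4 ≤
        2 ^ 25 / (q : ℝ) ^ 4 * 2 := by gcongr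
    have h5 : 8 * (1 / (q : ℝ) ^ 4) + 2 ^ 25 / (q : ℝ) ^ 4 * 2 ≤ 2 ^ 27 / (q : ℝ) ^ 4 := by
      rw [← sub_nonneg]
      have : 2 ^ 27 / (q : ℝ) ^ 4 - (8 * (1 / (q : ℝ) ^ 4) + 2 ^ 25 / (q : ℝ) ^ 4 * 2) =
        (2 ^ 27 - 8 - 2 ^ 26) * (1 / (q : ℝ) ^ 4) := by ring
      rw [this]
      exact mul_nonneg (by norm_num) hQ.le
    linarith

end IncLogConcave

lemma IsLogConcave.le_succ_of_lt_mode {P : ℤ → ℝ} (hP : IsLogConcave P) (h0 : ∀ j, 0 ≤ P j)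
    {μ : ℤ} (hμ : ∀ j, P j ≤ P μ) {j : ℤ} (hj : j < μ) : P j ≤ P (j + 1) := by
  by_contra! hlt
  have pj : 0 < P j := (h0 _).trans_lt hlt
  have pμ : 0 < P μ := pj.trans_le (hμ j)
  have hpos : ∀ i, j ≤ i → i ≤ μ → 0 < P i := by
    intro i h1 h2
    rcases h1.eq_or_lt with rfl | h1
    · exact pj
    rcases h2.eq_or_lt with rfl | h2
    · exact pμ
    exact hP.1 j i μ h1 h2 (mul_pos pj pμ)
  have key : ∀ i, j ≤ i → i < μ → P (i + 1) < P i ∧ P (i + 1) < P j := by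
    intro i hi
    induction i, hi using Int.leInduction with
    | base => exact fun _ => ⟨hlt, hlt⟩
    | succ i hi ih =>
      intro h
      have h1 := ih (by omega)
      have h2 := hP.2 (i + 1)
      rw [add_sub_cancel_right] at h2
      have h3 := hpos (i + 1) (by omega) (by omega)
      have h4 := hpos i hi (by omega)
      have h5 : P (i + 1 + 1) < P (i + 1) := by
        by_contra! hc
        nlinarith
      exact ⟨h5, h5.trans h1.2⟩
  have := (key (μ - 1) (by omega) (by omega)).2
  rw [sub_add_cancel] at this
  exact absurd (hμ j) (not_le.2 this)

lemma IsLogConcave.incLogConcave {P : ℤ → ℝ} (hP : IsLogConcave P) (h0 : ∀ j, 0 ≤ P j)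
    {μ : ℕ} (hμ : ∀ j, P j ≤ P μ) : IncLogConcave fun j : ℕ => P ((min j μ : ℕ) : ℤ) where
  nonneg _ := h0 _
  mono := by
    refine monotone_nat_of_le_succ fun j => ?_
    rcases Nat.lt_or_ge j μ with h | h
    · rw [min_eq_left h.le, min_eq_left (by omega)]
      exact hP.le_succ_of_lt_mode h0 hμ (by exact_mod_cast h)
    · rw [min_eq_right h, min_eq_right (by omega)]
  log_concave j := by
    rcases Nat.lt_or_ge (j + 1) μ with h | h
    · simp only [min_eq_left (show j ≤ μ by omega), min_eq_left (show j + 1 ≤ μ by omega),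
        min_eq_left (show j + 2 ≤ μ by omega)]
      have := hP.2 ((j + 1 : ℕ) : ℤ)
      have e1 : ((j + 1 : ℕ) : ℤ) - 1 = j := by push_cast; ring
      have e2 : ((j + 1 : ℕ) : ℤ) + 1 = ((j + 2 : ℕ) : ℤ) := by push_cast; ring
      rwa [e1, e2] at this
    · simp only [min_eq_right h, min_eq_right (show μ ≤ j + 2 by omega)]
      rw [sq]
      exact mul_le_mul_of_nonneg_right (hμ _) (h0 _)

lemma IsLogConcave.reflect {P : ℤ → ℝ} (hP : IsLogConcave P) (a : ℤ) :
    IsLogConcave fun j => P (a - j) := by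
  refine ⟨fun i j l hij hjl h => hP.1 (a - l) (a - j) (a - i) (by omega) (by omega)
    (by rwa [mul_comm]), fun j => ?_⟩
  have := hP.2 (a - j)
  beta_reduce
  rw [show a - (j - 1) = a - j + 1 by ring, show a - (j + 1) = a - j - 1 by ring]
  rwa [mul_comm]

/-- Coded brackets on an initial interval to the left of a mode. -/
lemma exists_code_of_mode {P : ℤ → ℝ} (hD : IsDistr P) (hP : IsLogConcave P) {μ k n q : ℕ}
    (hμ : ∀ j, P j ≤ P μ) (hkμ : k ≤ μ + 1) (hn : 1 ≤ n) (hk : k ≤ n) (hq : 8192 ≤ q) {δ N : ℝ}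
    (hδ : 0 < δ) (hδ1 : 4 * δ ≤ 1 / 2)
    (hN : ((n : ℝ) ^ 2 * (q : ℝ) ^ 4 + 3 * n) / δ + 1 ≤ N) (hnN : (n : ℝ) ≤ N) :
    ∃ c : Fin 5 → Fin (20 * q + 1) → ℤ, (∀ i r, |(c i r : ℝ)| ≤ N) ∧
      (∀ j : ℕ, j < k → codeLower δ n c j ≤ P j ∧ P j ≤ codeUpper δ n c j) ∧
      (∀ j : ℤ, j < 0 ∨ (k : ℤ) ≤ j → codeLower δ n c j = 0 ∧ codeUpper δ n c j = 0) ∧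
      ∑ j ∈ Finset.range k, (Real.sqrt (codeUpper δ n c j) - Real.sqrt (codeLower δ n c j)) ^ 2 ≤
        32 * δ ^ 2 + 2 ^ 27 / (q : ℝ) ^ 4 := by
  have hf := hP.incLogConcave hD.1 hμ
  have hmin : ∀ j < k, ((min j μ : ℕ) : ℤ) = j := fun j hj => by
    rw [min_eq_left (by omega)]
  obtain ⟨c, h1, h2, h3, h4⟩ := hf.exists_code (k := k)
    (fun j => le_hasSum hD.2 _ fun i _ => hD.1 i) hn hk hq (by
      have := sum_le_hasSum ((Finset.range k).map Nat.castEmbedding) (fun i _ => hD.1 i) hD.2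
      rw [Finset.sum_map] at this
      refine le_trans (le_of_eq (Finset.sum_congr rfl fun j hj => ?_)) this
      rw [hmin j (Finset.mem_range.1 hj)]
      rfl) hδ hδ1 hN hnN
  refine ⟨c, h1, fun j hj => ?_, h3, h4⟩
  have := h2 j hj
  rwa [hmin j hj] at this

lemma hasSum_of_eq_zero_outside {g : ℤ → ℝ} {k : ℕ} (h : ∀ j : ℤ, j < 0 ∨ (k : ℤ) ≤ j → g j = 0) :
    HasSum g (∑ j ∈ Finset.range k, g j) := by
  have : HasSum g (∑ j ∈ (Finset.range k).map Nat.castEmbedding, g j) :=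
    hasSum_sum_of_ne_finset_zero fun j hj => h j <| by
      by_contra! hc
      refine hj (Finset.mem_map.2 ⟨j.toNat, Finset.mem_range.2 (by omega), ?_⟩)
      simp [hc.1]
  rw [Finset.sum_map] at this
  exact this

lemma codeLower_nonneg (δ : ℝ) (n : ℕ) {m : ℕ} (c : Fin 5 → Fin m → ℤ) (j : ℤ) :
    0 ≤ codeLower δ n c j :=
  Finset.sum_nonneg fun r _ => by split_ifs <;> positivity

lemma codeUpper_nonneg (δ : ℝ) (n : ℕ) {m : ℕ} (c : Fin 5 → Fin m → ℤ) (j : ℤ) :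
    0 ≤ codeUpper δ n c j :=
  Finset.sum_nonneg fun r _ => by split_ifs <;> positivity

/-- The bracket obtained from codes for the left part and for the reflected right part. -/
noncomputable def codeBracket (δ : ℝ) (n : ℕ) {m : ℕ}
    (c : (Fin 5 → Fin m → ℤ) × (Fin 5 → Fin m → ℤ)) : (ℤ → ℝ) × (ℤ → ℝ) :=
  (fun j => codeLower δ n c.1 j + codeLower δ n c.2 ((n : ℤ) - 1 - j),
    fun j => codeUpper δ n c.1 j + codeUpper δ n c.2 ((n : ℤ) - 1 - j))

/-- Every log-concave distribution on `{0, …, n - 1}` admits a coded bracket. -/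
lemma exists_codeBracket {P : ℤ → ℝ} {n q : ℕ} (hP : P ∈ LCVclass n) (hn : 1 ≤ n) (hq : 8192 ≤ q)
    {δ N ε : ℝ} (hδ : 0 < δ) (hδ1 : 4 * δ ≤ 1 / 2)
    (hN : ((n : ℝ) ^ 2 * (q : ℝ) ^ 4 + 3 * n) / δ + 1 ≤ N) (hnN : (n : ℝ) ≤ N) (hε : 0 < ε)
    (hcost : 32 * δ ^ 2 + 2 ^ 27 / (q : ℝ) ^ 4 ≤ ε ^ 2) :
    ∃ c : (Fin 5 → Fin (20 * q + 1) → ℤ) × (Fin 5 → Fin (20 * q + 1) → ℤ),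
      (∀ i r, |(c.1 i r : ℝ)| ≤ N) ∧ (∀ i r, |(c.2 i r : ℝ)| ≤ N) ∧
      (IsPseudoDistr (codeBracket δ n c).1 ∧ IsPseudoDistr (codeBracket δ n c).2 ∧
        hellinger (codeBracket δ n c).1 (codeBracket δ n c).2 ≤ ε) ∧
      ∀ j : ℤ, (codeBracket δ n c).1 j ≤ P j ∧ P j ≤ (codeBracket δ n c).2 j := by
  obtain ⟨hD, hLC, hsupp⟩ := hP
  obtain ⟨μ, hμn, hμ⟩ : ∃ μ : ℕ, μ < n ∧ ∀ j, P j ≤ P μ := by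
    obtain ⟨μ, hμ, hmax⟩ := Finset.exists_max_image (Finset.range n) (fun j : ℕ => P j)
      ⟨0, Finset.mem_range.2 (by omega)⟩
    refine ⟨μ, Finset.mem_range.1 hμ, fun j => ?_⟩
    by_cases hj : j < 0 ∨ (n : ℤ) ≤ j
    · rw [hsupp j hj]; exact hD.1 _
    · push Not at hj
      have := hmax j.toNat (Finset.mem_range.2 (by omega))
      rwa [Int.toNat_of_nonneg hj.1] at this
  let e : ℤ ≃ ℤ := Equiv.subLeft ((n : ℤ) - 1)
  have hD' : IsDistr fun j => P ((n : ℤ) - 1 - j) :=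
    ⟨fun _ => hD.1 _, (Equiv.hasSum_iff e).2 hD.2⟩
  obtain ⟨c₁, a1, a2, a3, a4⟩ := exists_code_of_mode hD hLC (k := μ + 1) hμ le_rfl hn (by omega)
    hq hδ hδ1 hN hnN
  obtain ⟨c₂, b1, b2, b3, b4⟩ := exists_code_of_mode hD' (hLC.reflect _) (μ := n - 1 - μ)
    (k := n - 1 - μ) (fun j => by
      have : (n : ℤ) - 1 - ((n - 1 - μ : ℕ) : ℤ) = μ := by omega
      rw [this]; exact hμ _) (by omega) hn (by omega) hq hδ hδ1 hN hnN
  have hsplit : ∀ j : ℤ,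
      (codeLower δ n c₁ j = 0 ∧ codeUpper δ n c₁ j = 0) ∨
      (codeLower δ n c₂ ((n : ℤ) - 1 - j) = 0 ∧ codeUpper δ n c₂ ((n : ℤ) - 1 - j) = 0) := by
    intro j
    rcases le_or_gt ((μ + 1 : ℕ) : ℤ) j with h | h
    · exact Or.inl (a3 j (Or.inr h))
    · exact Or.inr (b3 _ (Or.inr (by omega)))
  have sum₁ : ∀ g : ℤ → ℝ, (∀ j : ℤ, j < 0 ∨ ((μ + 1 : ℕ) : ℤ) ≤ j → g j = 0) →
      HasSum g (∑ j ∈ Finset.range (μ + 1), g j) := fun g hg => hasSum_of_eq_zero_outside hg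
  have sum₂ : ∀ g : ℤ → ℝ, (∀ j : ℤ, j < 0 ∨ ((n - 1 - μ : ℕ) : ℤ) ≤ j → g j = 0) →
      HasSum (fun j => g ((n : ℤ) - 1 - j)) (∑ j ∈ Finset.range (n - 1 - μ), g j) :=
    fun g hg => (Equiv.hasSum_iff e).2 (hasSum_of_eq_zero_outside hg)
  refine ⟨(c₁, c₂), a1, b1, ⟨⟨fun j => ?_, ?_⟩, ⟨fun j => ?_, ?_⟩, ?_⟩, fun j => ?_⟩
  · exact add_nonneg (codeLower_nonneg _ _ _ _) (codeLower_nonneg _ _ _ _)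
  · exact ((sum₁ _ fun j hj => (a3 j hj).1).add (sum₂ _ fun j hj => (b3 j hj).1)).summable
  · exact add_nonneg (codeUpper_nonneg _ _ _ _) (codeUpper_nonneg _ _ _ _)
  · exact ((sum₁ _ fun j hj => (a3 j hj).2).add (sum₂ _ fun j hj => (b3 j hj).2)).summable
  · have hs := (sum₁ (fun j => (Real.sqrt (codeUpper δ n c₁ j) -
        Real.sqrt (codeLower δ n c₁ j)) ^ 2) fun j hj => by simp [a3 j hj]).add
      (sum₂ (fun j => (Real.sqrt (codeUpper δ n c₂ j) -
        Real.sqrt (codeLower δ n c₂ j)) ^ 2) fun j hj => by simp [b3 j hj])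
    have heq : ∀ j : ℤ, (Real.sqrt ((codeBracket δ n (c₁, c₂)).1 j) -
        Real.sqrt ((codeBracket δ n (c₁, c₂)).2 j)) ^ 2 =
        (Real.sqrt (codeUpper δ n c₁ j) - Real.sqrt (codeLower δ n c₁ j)) ^ 2 +
        (Real.sqrt (codeUpper δ n c₂ ((n : ℤ) - 1 - j)) -
          Real.sqrt (codeLower δ n c₂ ((n : ℤ) - 1 - j))) ^ 2 := by
      intro j
      simp only [codeBracket]
      rcases hsplit j with h | h <;> rw [h.1, h.2] <;> simp <;> ring
    rw [hellinger, tsum_congr heq, hs.tsum_eq]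
    refine Real.sqrt_le_iff.2 ⟨hε.le, ?_⟩
    linarith
  · simp only [codeBracket]
    by_cases hj0 : j < 0
    · have h1 := a3 j (Or.inl hj0)
      have h2 := b3 ((n : ℤ) - 1 - j) (Or.inr (by omega))
      rw [h1.1, h1.2, h2.1, h2.2, hsupp j (Or.inl hj0)]
      simp
    by_cases hjn : (n : ℤ) ≤ j
    · have h1 := a3 j (Or.inr (by omega))
      have h2 := b3 ((n : ℤ) - 1 - j) (Or.inl (by omega))
      rw [h1.1, h1.2, h2.1, h2.2, hsupp j (Or.inr hjn)]
      simp
    by_cases hjμ : j < ((μ + 1 : ℕ) : ℤ)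
    · have h1 := a2 j.toNat (by omega)
      have h2 := b3 ((n : ℤ) - 1 - j) (Or.inr (by omega))
      rw [Int.toNat_of_nonneg (by omega)] at h1
      rw [h2.1, h2.2, add_zero, add_zero]
      exact h1
    · have h1 := a3 j (Or.inr (by omega))
      have h2 := b2 ((n : ℤ) - 1 - j).toNat (by omega)
      rw [Int.toNat_of_nonneg (by omega), sub_sub_cancel] at h2
      rw [h1.1, h1.2, zero_add, zero_add]
      exact h2

/-- Codes with entries bounded by `M`. -/
noncomputable def codes (m : ℕ) (M : ℤ) : Finset (Fin 5 → Fin m → ℤ) :=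
  Fintype.piFinset fun _ => Fintype.piFinset fun _ => Finset.Icc (-M) M

lemma mem_codes {m : ℕ} {N : ℝ} {c : Fin 5 → Fin m → ℤ} (h : ∀ i r, |(c i r : ℝ)| ≤ N) :
    c ∈ codes m ⌊N⌋ := by
  simp only [codes, Fintype.mem_piFinset, Finset.mem_Icc]
  intro i r
  have := h i r
  rw [← Int.cast_abs, ← Int.le_floor] at this
  exact abs_le.1 this

lemma card_codes_le {m : ℕ} {N X : ℝ} (hN : 0 ≤ N) (h : 2 * N + 1 ≤ X) :
    ((codes m ⌊N⌋).card : ℝ) ≤ X ^ (5 * m) := by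
  have hM : 0 ≤ ⌊N⌋ := Int.floor_nonneg.2 hN
  have hcard : ((Finset.Icc (-⌊N⌋) ⌊N⌋).card : ℝ) ≤ X := by
    rw [Int.card_Icc]
    have h1 : (((⌊N⌋ + 1 - -⌊N⌋).toNat : ℤ) : ℝ) = 2 * (⌊N⌋ : ℝ) + 1 := by
      rw [Int.toNat_of_nonneg (by omega)]; push_cast; ring
    rw [Int.cast_natCast] at h1
    rw [h1]
    linarith [Int.floor_le N]
  simp only [codes, Fintype.card_piFinset_const]
  push_cast
  rw [mul_comm 5 m, pow_mul]
  gcongr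

/-- Bracketing entropy bound for discrete log-concave distributions: the `ε`-bracketing
number of `LCV_n` with respect to Hellinger distance is at most `(n/ε)^{c/√ε}`; i.e. there
is a collection of at most `(n/ε)^{c/√ε}` pairs of pseudo-distributions, each pair at
Hellinger distance at most `ε`, bracketing every member of `LCV_n` pointwise. -/
theorem bracketing_entropy_logconcave :
    ∃ c : ℝ, 0 < c ∧
      ∀ n : ℕ, 2 ≤ n → ∀ ε : ℝ, 0 < ε → ε < 1 →
        ∃ T : Finset ((ℤ → ℝ) × (ℤ → ℝ)),
          (T.card : ℝ) ≤ ((n : ℝ) / ε) ^ (c / Real.sqrt ε) ∧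
          (∀ pr ∈ T, IsPseudoDistr pr.1 ∧ IsPseudoDistr pr.2 ∧ hellinger pr.1 pr.2 ≤ ε) ∧
          ∀ P ∈ LCVclass n, ∃ pr ∈ T, ∀ j : ℤ, pr.1 j ≤ P j ∧ P j ≤ pr.2 j := by
  classical
  refine ⟨650 * 21 * 2 ^ 14, by norm_num, fun n hn ε hε hε1 => ?_⟩
  have hn2 : (2 : ℝ) ≤ n := by exact_mod_cast hn
  have hs : 0 < Real.sqrt ε := Real.sqrt_pos.2 hε
  have hs1 : Real.sqrt ε ≤ 1 := Real.sqrt_le_one.2 hε1.le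
  have hs2 : Real.sqrt ε ^ 2 = ε := Real.sq_sqrt hε.le
  obtain ⟨q, hq, hq', hqR⟩ : ∃ q : ℕ, 8192 ≤ q ∧ 8192 / Real.sqrt ε ≤ q ∧
      (q : ℝ) ≤ 2 ^ 14 / Real.sqrt ε := by
    have h1 : 8192 ≤ 8192 / Real.sqrt ε := by
      rw [le_div_iff₀ hs]; linarith
    refine ⟨⌈8192 / Real.sqrt ε⌉₊, ?_, Nat.le_ceil _, ?_⟩
    · exact_mod_cast h1.trans (Nat.le_ceil _)
    · have h2 := Nat.ceil_lt_add_one (a := 8192 / Real.sqrt ε) (by positivity)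
      have h3 : 2 ^ 14 / Real.sqrt ε = 8192 / Real.sqrt ε + 8192 / Real.sqrt ε := by ring
      linarith
  have hq0 : (0 : ℝ) < q := by
    have : (8192 : ℝ) ≤ q := by exact_mod_cast hq
    linarith
  set X : ℝ := n / ε with hX
  have hnX : (n : ℝ) ≤ X := by
    rw [hX, le_div_iff₀ hε]; nlinarith
  have hX2 : 2 ≤ X := hn2.trans hnX
  have hX1 : 1 / ε ≤ X := by rw [hX]; gcongr; linarith
  have hX3 : X ≤ X ^ 3 := le_self_pow₀ (by linarith) (by norm_num)
  have hX31 : 1 ≤ X ^ 3 := one_le_pow₀ (by linarith)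
  have hq4 : (q : ℝ) ^ 4 ≤ 2 ^ 56 / ε ^ 2 := by
    calc (q : ℝ) ^ 4 ≤ (2 ^ 14 / Real.sqrt ε) ^ 4 := by gcongr
      _ = 2 ^ 56 / (Real.sqrt ε ^ 2) ^ 2 := by rw [div_pow]; ring
      _ = _ := by rw [hs2]
  have hcost : 32 * (ε / 8) ^ 2 + 2 ^ 27 / (q : ℝ) ^ 4 ≤ ε ^ 2 := by
    have h1 : (8192 / Real.sqrt ε) ^ 4 ≤ (q : ℝ) ^ 4 := by gcongr
    have h2 : (8192 / Real.sqrt ε) ^ 4 = 2 ^ 52 / ε ^ 2 := by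
      calc _ = 2 ^ 52 / (Real.sqrt ε ^ 2) ^ 2 := by rw [div_pow]; ring
        _ = _ := by rw [hs2]
    rw [h2, div_le_iff₀ (by positivity)] at h1
    have h3 : 2 ^ 27 / (q : ℝ) ^ 4 ≤ ε ^ 2 / 2 := by
      rw [div_le_iff₀ (by positivity)]
      linarith
    linarith
  set N : ℝ := 2 ^ 60 * X ^ 3 with hNdef
  have hN : ((n : ℝ) ^ 2 * (q : ℝ) ^ 4 + 3 * n) / (ε / 8) + 1 ≤ N := by
    have h1 : (n : ℝ) ^ 2 * (q : ℝ) ^ 4 ≤ 2 ^ 56 * X ^ 2 := by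
      calc _ ≤ (n : ℝ) ^ 2 * (2 ^ 56 / ε ^ 2) := by gcongr
        _ = _ := by rw [hX]; ring
    calc _ ≤ (2 ^ 56 * X ^ 2 + 3 * X) / (ε / 8) + 1 := by gcongr
      _ = (2 ^ 56 * X ^ 2 + 3 * X) * 8 * (1 / ε) + 1 := by ring
      _ ≤ (2 ^ 56 * X ^ 2 + 3 * X) * 8 * X + 1 := by gcongr
      _ ≤ N := by
        rw [hNdef]
        nlinarith
  have hnN : (n : ℝ) ≤ N := by rw [hNdef]; linarith
  have hNX : 2 * N + 1 ≤ X ^ 65 := by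
    calc 2 * N + 1 ≤ 2 ^ 62 * X ^ 3 := by rw [hNdef]; linarith
      _ ≤ X ^ 62 * X ^ 3 := by gcongr
      _ = X ^ 65 := by ring
  refine ⟨(((codes (20 * q + 1) ⌊N⌋) ×ˢ (codes (20 * q + 1) ⌊N⌋)).image
    (codeBracket (ε / 8) n)).filter fun pr =>
      IsPseudoDistr pr.1 ∧ IsPseudoDistr pr.2 ∧ hellinger pr.1 pr.2 ≤ ε, ?_,
    fun pr hpr => (Finset.mem_filter.1 hpr).2, fun P hP => ?_⟩
  · have hc := card_codes_le (m := 20 * q + 1) (by linarith : (0 : ℝ) ≤ N) hNX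
    have h1 := (Finset.card_filter_le (((codes (20 * q + 1) ⌊N⌋) ×ˢ
      (codes (20 * q + 1) ⌊N⌋)).image (codeBracket (ε / 8) n)) fun pr =>
      IsPseudoDistr pr.1 ∧ IsPseudoDistr pr.2 ∧ hellinger pr.1 pr.2 ≤ ε).trans
      Finset.card_image_le
    rw [Finset.card_product] at h1
    have hexp : ((650 * (20 * q + 1) : ℕ) : ℝ) ≤ 650 * 21 * 2 ^ 14 / Real.sqrt ε := by
      have h2 : (1 : ℝ) ≤ q := by exact_mod_cast (by omega : 1 ≤ q)
      push_cast
      calc (650 * (20 * (q : ℝ) + 1)) ≤ 650 * 21 * q := by linarith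
        _ ≤ 650 * 21 * (2 ^ 14 / Real.sqrt ε) := by gcongr
        _ = _ := by ring
    calc _ ≤ ((codes (20 * q + 1) ⌊N⌋).card : ℝ) * ((codes (20 * q + 1) ⌊N⌋).card : ℝ) := by
          exact_mod_cast h1
      _ ≤ (X ^ 65) ^ (5 * (20 * q + 1)) * (X ^ 65) ^ (5 * (20 * q + 1)) := by gcongr
      _ = X ^ (650 * (20 * q + 1)) := by
          rw [← pow_add, ← pow_mul]; congr 1; ring
      _ = X ^ ((650 * (20 * q + 1) : ℕ) : ℝ) := (Real.rpow_natCast _ _).symm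
      _ ≤ _ := Real.rpow_le_rpow_of_exponent_le (by linarith) hexp
  · obtain ⟨c, h1, h2, h3, h4⟩ := exists_codeBracket hP (by omega) hq (by positivity : 0 < ε / 8)
      (by linarith) hN hnN hε hcost
    exact ⟨codeBracket (ε / 8) n c, Finset.mem_filter.2 ⟨Finset.mem_image.2 ⟨c,
      Finset.mem_product.2 ⟨mem_codes h1, mem_codes h2⟩, rfl⟩, h3⟩, h4⟩

end Stmt17
end

section
/- There is an absolute constant C > 0 such that for every discrete log-concave distribution p on ℤ and every ε ∈ (0,1), there exists a pseudo-distribution g : ℤ → ℝ≥0 such that: (i) there exist integers a ≤ b and a partition of the integer interval {a,...,b} into at most C/√ε subintervals on each of which g agrees with an affine function; (ii) g vanishes outside {a,...,b} and p(ℤ \ {a,...,b}) ≤ C·ε²; and (iii) H(p,g) ≤ ε. Moreover, one may additionally require either g(j) ≤ p(j) for all j ∈ {a,...,b}, or p(j) ≤ g(j) for all j ∈ {a,...,b}. -/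
open scoped BigOperators

namespace Stmt18

/-- A (discrete) probability distribution on `α`, given by its probability mass function. -/
def IsDistr {α : Type*} (P : α → ℝ) : Prop :=
  (∀ a, 0 ≤ P a) ∧ HasSum P 1

/-- A distribution `P` on `ℤ` is log-concave if (i) it has no "internal zeros" and
(ii) `P(j)² ≥ P(j-1)·P(j+1)` for all `j`. -/
def IsLogConcave (P : ℤ → ℝ) : Prop :=
  (∀ i j l : ℤ, i < j → j < l → 0 < P i * P l → 0 < P j) ∧
  (∀ j : ℤ, P (j - 1) * P (j + 1) ≤ P j ^ 2)

/-- Hellinger distance between pseudo-distributions on `ℤ`. -/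
noncomputable def hellinger (f g : ℤ → ℝ) : ℝ :=
  Real.sqrt ((1 / 2) * ∑' j : ℤ, (Real.sqrt (f j) - Real.sqrt (g j)) ^ 2)

/-- `g` is a good piecewise-affine approximation of `P` on `{a,…,b}` at scale `ε`
(with constant `C`): `g` is a pseudo-distribution which is piecewise affine on at most
`C/√ε` subintervals partitioning `{a,…,b}`, vanishes outside `{a,…,b}`, the mass of `P`
outside `{a,…,b}` is at most `C·ε²`, and `H(P,g) ≤ ε`. -/
def GoodApprox (C : ℝ) (P : ℤ → ℝ) (ε : ℝ) (g : ℤ → ℝ) (a b : ℤ) : Prop :=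
  (∀ j, 0 ≤ g j) ∧ Summable g ∧
  (∃ N : ℕ, (N : ℝ) ≤ C / Real.sqrt ε ∧
    ∃ c : ℕ → ℤ, c 0 = a ∧ c N = b + 1 ∧ (∀ i < N, c i < c (i + 1)) ∧
      ∀ i < N, ∃ α β : ℝ, ∀ j : ℤ, c i ≤ j → j < c (i + 1) → g j = α * (j : ℝ) + β) ∧
  (∀ j : ℤ, (j < a ∨ b < j) → g j = 0) ∧
  (∑' j : ℤ, (if j < a ∨ b < j then P j else 0)) ≤ C * ε ^ 2 ∧
  hellinger P g ≤ ε

/-- Greedy partition of `{0,…,B}` into intervals across which `Φ` increases by at most `η`,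
while it increases by at least `η` from each interval to the next. -/
lemma exists_partition_of_oscillation (Φ : ℕ → ℝ) {η : ℝ} (hη : 0 ≤ η) (B : ℕ) :
    ∃ N : ℕ, ∃ c : ℕ → ℕ, c 0 = 0 ∧ c (N + 1) = B + 1 ∧ (∀ i < N + 1, c i < c (i + 1)) ∧
      (∀ i < N + 1, Φ (c (i + 1) - 1) - Φ (c i) ≤ η) ∧ N * η ≤ Φ (c N) - Φ 0 := by
  induction B with
  | zero =>
    refine ⟨0, id, rfl, rfl, by simp, ?_, by simp⟩
    intro i hi
    obtain rfl : i = 0 := by omega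
    simpa using hη
  | succ B ih =>
    obtain ⟨N, c, h0, hN, hlt, hsp, hcount⟩ := ih
    have hcN : c N < B + 1 := hN ▸ hlt N (by omega)
    by_cases h : Φ (B + 1) - Φ (c N) ≤ η
    · refine ⟨N, Function.update c (N + 1) (B + 2), by simp [h0], by simp, ?_, ?_, by simpa⟩
      · intro i hi
        rcases Nat.lt_succ_iff_lt_or_eq.1 hi with hi' | rfl
        · have h1 : i ≠ N + 1 := by omega
          have h2 : i + 1 ≠ N + 1 := by omega
          simpa only [h1, h2, Function.update_of_ne, ne_eq, not_false_eq_true] using hlt i hi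
        · simp
          omega
      · intro i hi
        rcases Nat.lt_succ_iff_lt_or_eq.1 hi with hi' | rfl
        · have h1 : i ≠ N + 1 := by omega
          have h2 : i + 1 ≠ N + 1 := by omega
          simpa only [h1, h2, Function.update_of_ne, ne_eq, not_false_eq_true] using hsp i hi
        · simpa using h
    · refine ⟨N + 1, Function.update c (N + 2) (B + 2), by simp [h0], by simp, ?_, ?_, ?_⟩
      · intro i hi
        rcases Nat.lt_succ_iff_lt_or_eq.1 hi with hi' | rfl
        · have h1 : i ≠ N + 2 := by omega
          have h2 : i + 1 ≠ N + 2 := by omega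
          simpa only [h1, h2, Function.update_of_ne, ne_eq, not_false_eq_true] using hlt i hi'
        · simp [hN]
      · intro i hi
        rcases Nat.lt_succ_iff_lt_or_eq.1 hi with hi' | rfl
        · have h1 : i ≠ N + 2 := by omega
          have h2 : i + 1 ≠ N + 2 := by omega
          simpa only [h1, h2, Function.update_of_ne, ne_eq, not_false_eq_true] using hsp i hi'
        · simpa [hN] using hη
      · have : Function.update c (N + 2) (B + 2) (N + 1) = B + 1 := by
          rw [Function.update_of_ne (by omega), hN]
        rw [this]
        push_cast
        linarith

lemma sqrt_sub_sqrt_sq_le_abs {a b : ℝ} (ha : 0 ≤ a) (hb : 0 ≤ b) :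
    (√a - √b) ^ 2 ≤ |a - b| := by
  have h1 := Real.sq_sqrt ha
  have h2 := Real.sq_sqrt hb
  have h3 := Real.sqrt_nonneg a
  have h4 := Real.sqrt_nonneg b
  have h5 : a - b = (√a - √b) * (√a + √b) := by nlinarith
  rw [h5, abs_mul, ← sq_abs, sq, abs_of_nonneg (add_nonneg h3 h4)]
  refine mul_le_mul_of_nonneg_left ?_ (abs_nonneg _)
  rw [abs_le]
  constructor <;> linarith

lemma mul_sqrt_sub_sqrt_sq_le {a b c : ℝ} (hc : 0 ≤ c) (hca : c ≤ a) (hb : 0 ≤ b) :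
    c * (√a - √b) ^ 2 ≤ (a - b) ^ 2 := by
  have h1 := Real.sq_sqrt (hc.trans hca)
  have h2 := Real.sq_sqrt hb
  have h3 := Real.sqrt_nonneg a
  have h4 := Real.sqrt_nonneg b
  have h5 : a - b = (√a - √b) * (√a + √b) := by nlinarith
  rw [h5, mul_pow, mul_comm]
  refine mul_le_mul_of_nonneg_left ?_ (sq_nonneg _)
  nlinarith

lemma pow_five_sub_le {a b : ℝ} (hb : 0 ≤ b) (hab : b ≤ a) :
    a ^ 5 - b ^ 5 ≤ 5 * a ^ 4 * (a - b) := by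
  have ha := hb.trans hab
  have h : a ^ 5 - b ^ 5 = (a - b) * (a ^ 4 + a ^ 3 * b + a ^ 2 * b ^ 2 + a * b ^ 3 + b ^ 4) := by
    ring
  have h1 : a ^ 3 * b ≤ a ^ 3 * a := by gcongr
  have h2 : a ^ 2 * b ^ 2 ≤ a ^ 2 * a ^ 2 := by gcongr
  have h3 : a * b ^ 3 ≤ a * a ^ 3 := by gcongr
  have h4 : b ^ 4 ≤ a ^ 4 := by gcongr
  rw [h, mul_comm]
  refine mul_le_mul_of_nonneg_right ?_ (sub_nonneg.2 hab)
  nlinarith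

section Numeric

variable {M V V' u₁ u₂ z₁ z₂ η w : ℝ}

lemma mul_add_mul_le (hVV : V ≤ 2 * V') (hM : 0 ≤ M) (hu₁ : 0 ≤ u₁) (hw : 0 ≤ w)
    (hwM : w * M * V' ≤ η) (hwu : w * u₁ * V' ≤ η) : w * (M + u₁) * V ≤ 4 * η := by
  have : w * (M + u₁) * V ≤ w * (M + u₁) * (2 * V') := by gcongr
  nlinarith

/-- Error of a constant approximation on a piece where the slope at least doubles. -/
lemma const_error_le (hM : 0 ≤ M) (hV : 0 ≤ V) (hV1 : V ≤ 1) (hVV : V ≤ 2 * V') (hu₁ : 0 ≤ u₁)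
    (hz₁ : 0 ≤ z₁) (hz : z₁ ≤ 2 * η) (hzM : z₁ ^ 4 * (M + u₁) = M)
    (hw : 1 ≤ w) (hwM : w * M * V' ≤ η) (hwu : w * u₁ * V' ≤ η) :
    (w + 1) * (M * V ^ 5) ≤ 128 * η ^ 5 := by
  have h := mul_add_mul_le hVV hM hu₁ (by linarith) hwM hwu
  have h4 : V ^ 4 ≤ 1 := pow_le_one₀ hV hV1
  have hη : 0 ≤ η := by linarith
  calc (w + 1) * (M * V ^ 5) ≤ (w + w) * (M * V ^ 5) := by gcongr
    _ = (w + w) * (z₁ ^ 4 * (M + u₁) * V ^ 5) := by rw [hzM]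
    _ = 2 * z₁ ^ 4 * (w * (M + u₁) * V) * V ^ 4 := by ring
    _ ≤ 2 * (2 * η) ^ 4 * (4 * η) * 1 := by gcongr
    _ = 128 * η ^ 5 := by ring

/-- Error of an affine approximation on a piece where the slope varies little. -/
lemma affine_error_le (hM : 0 < M) (hV' : 0 < V') (hV'V : V' ≤ V) (hV1 : V ≤ 1)
    (hVV : V ≤ 2 * V') (hu₁ : 0 ≤ u₁) (hu : u₁ ≤ u₂) (hu₂ : u₂ ≤ 1) (hz₂ : 0 < z₂) (hz : z₂ ≤ z₁)
    (hz1 : z₁ ≤ 1) (hzz : z₁ ≤ 2 * z₂) (hzη : z₁ - z₂ ≤ η)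
    (hzM₁ : z₁ ^ 4 * (M + u₁) = M) (hzM₂ : z₂ ^ 4 * (M + u₂) = M)
    (hw : 1 ≤ w) (hwM : w * M * V' ≤ η) (hwu : w * u₁ * V' ≤ η) (hd : V - V' ≤ w * V * u₂) :
    (w + 1) * (w * (M * V ^ 5 * (1 - (1 - u₂) ^ 5) - M * V' ^ 5 * (1 - (1 - u₁) ^ 5))) ^ 2 ≤
      15099494400 * η ^ 5 * (M * V' ^ 5) := by
  have hwt := mul_add_mul_le hVV hM.le hu₁ (by linarith) hwM hwu
  set t := M + u₁ with ht
  have hV : 0 < V := hV'.trans_le hV'V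
  have hz₁ : 0 < z₁ := hz₂.trans_le hz
  have htp : 0 < t := by positivity
  have hη : 0 ≤ η := by linarith
  have hw0 : 0 ≤ w := by linarith
  have hz4 : z₁ ^ 4 ≤ 16 * z₂ ^ 4 := by
    calc z₁ ^ 4 ≤ (2 * z₂) ^ 4 := by gcongr
      _ = _ := by ring
  have ht2 : M + u₂ ≤ 16 * t := by
    have : z₂ ^ 4 * (M + u₂) ≤ z₂ ^ 4 * (16 * t) := by nlinarith
    exact le_of_mul_le_mul_left this (by positivity)
  have hΔ : z₁ * (u₂ - u₁) ≤ 64 * (t * η) := by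
    have h1 : z₁ ^ 4 - z₂ ^ 4 ≤ 4 * z₁ ^ 3 * η := by
      have e : z₁ ^ 4 - z₂ ^ 4 = (z₁ - z₂) * (z₁ ^ 3 + z₁ ^ 2 * z₂ + z₁ * z₂ ^ 2 + z₂ ^ 3) := by
        ring
      have e1 : z₁ ^ 2 * z₂ ≤ z₁ ^ 2 * z₁ := by gcongr
      have e2 : z₁ * z₂ ^ 2 ≤ z₁ * z₁ ^ 2 := by gcongr
      have e3 : z₂ ^ 3 ≤ z₁ ^ 3 := by gcongr
      rw [e]
      calc _ ≤ η * (4 * z₁ ^ 3) := by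
            refine mul_le_mul hzη (by nlinarith) (by positivity) hη
        _ = _ := by ring
    have h2 : z₂ ^ 4 * (u₂ - u₁) = (z₁ ^ 4 - z₂ ^ 4) * t := by
      rw [sub_mul, hzM₁, ← hzM₂, ht]; ring
    have h3 : z₁ ^ 3 * (z₁ * (u₂ - u₁)) ≤ z₁ ^ 3 * (64 * (t * η)) := by
      calc z₁ ^ 3 * (z₁ * (u₂ - u₁)) = z₁ ^ 4 * (u₂ - u₁) := by ring
        _ ≤ 16 * z₂ ^ 4 * (u₂ - u₁) := by gcongr
        _ = 16 * ((z₁ ^ 4 - z₂ ^ 4) * t) := by rw [← h2]; ring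
        _ ≤ 16 * ((4 * z₁ ^ 3 * η) * t) := by gcongr
        _ = _ := by ring
    exact le_of_mul_le_mul_left h3 (by positivity)
  have hVd : V - V' ≤ 16 * (w * V * t) := by
    calc V - V' ≤ w * V * u₂ := hd
      _ ≤ w * V * (16 * t) := by gcongr; linarith
      _ = _ := by ring
  set X := M * V ^ 5 * (1 - (1 - u₂) ^ 5) - M * V' ^ 5 * (1 - (1 - u₁) ^ 5) with hX
  have hXle : X ≤ M * V ^ 5 * (5 * (u₂ - u₁) + 400 * (w * t ^ 2)) := by
    have h1 : (1 - u₁) ^ 5 - (1 - u₂) ^ 5 ≤ 5 * (u₂ - u₁) := by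
      have := pow_five_sub_le (a := 1 - u₁) (b := 1 - u₂) (by linarith) (by linarith)
      have h4 : (1 - u₁) ^ 4 ≤ 1 := pow_le_one₀ (by linarith) (by linarith)
      nlinarith
    have h2 : 1 - (1 - u₁) ^ 5 ≤ 5 * t := by
      have := pow_five_sub_le (a := 1) (b := 1 - u₁) (by linarith) (by linarith)
      linarith
    have h2' : 0 ≤ 1 - (1 - u₁) ^ 5 := sub_nonneg.2 (pow_le_one₀ (by linarith) (by linarith))
    have h3 := pow_five_sub_le hV'.le hV'V
    have h3' : V ^ 5 - V' ^ 5 ≤ 5 * V ^ 4 * (16 * (w * V * t)) := h3.trans (by gcongr)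
    calc X = M * V ^ 5 * ((1 - u₁) ^ 5 - (1 - u₂) ^ 5)
          + M * ((1 - (1 - u₁) ^ 5) * (V ^ 5 - V' ^ 5)) := by rw [hX]; ring
      _ ≤ M * V ^ 5 * (5 * (u₂ - u₁)) + M * ((5 * t) * (5 * V ^ 4 * (16 * (w * V * t)))) := by
          gcongr
          exact sub_nonneg.2 (by gcongr)
      _ = _ := by ring
  have hX0 : 0 ≤ X := by
    rw [hX, sub_nonneg]
    have : 0 ≤ 1 - (1 - u₁) ^ 5 := sub_nonneg.2 (pow_le_one₀ (by linarith) (by linarith))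
    gcongr
  have hzX : z₁ * (w * X) ≤ 7680 * (M * V ^ 3 * η ^ 2) := by
    calc z₁ * (w * X) ≤ z₁ * (w * (M * V ^ 5 * (5 * (u₂ - u₁) + 400 * (w * t ^ 2)))) := by gcongr
      _ = w * (M * V ^ 5 * (5 * (z₁ * (u₂ - u₁)) + z₁ * (400 * (w * t ^ 2)))) := by ring
      _ ≤ w * (M * V ^ 5 * (5 * (64 * (t * η)) + 1 * (400 * (w * t ^ 2)))) := by gcongr
      _ = M * V ^ 3 * (320 * (V * (w * t * V)) * η + 400 * (w * t * V) ^ 2) := by ring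
      _ ≤ M * V ^ 3 * (320 * (1 * (4 * η)) * η + 400 * (4 * η) ^ 2) := by gcongr
      _ = _ := by ring
  have hV5 : V ^ 5 ≤ 32 * V' ^ 5 := by
    calc V ^ 5 ≤ (2 * V') ^ 5 := by gcongr
      _ = _ := by ring
  have hfin : z₁ ^ 2 * ((w + 1) * (w * X) ^ 2) ≤ z₁ ^ 2 * (15099494400 * η ^ 5 * (M * V' ^ 5)) := by
    calc z₁ ^ 2 * ((w + 1) * (w * X) ^ 2) = (w + 1) * (z₁ * (w * X)) ^ 2 := by ring
      _ ≤ (w + w) * (7680 * (M * V ^ 3 * η ^ 2)) ^ 2 := by gcongr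
      _ = 117964800 * (w * M * V) * (M * V ^ 5) * η ^ 4 := by ring
      _ = 117964800 * (w * (z₁ ^ 4 * t) * V) * (M * V ^ 5) * η ^ 4 := by rw [hzM₁]
      _ = 117964800 * (z₁ ^ 2 * z₁ ^ 2 * (w * t * V)) * (M * V ^ 5) * η ^ 4 := by ring
      _ ≤ 117964800 * (z₁ ^ 2 * 1 * (4 * η)) * (M * (32 * V' ^ 5)) * η ^ 4 := by
          gcongr
          exact pow_le_one₀ hz₁.le hz1
      _ = _ := by ring
  exact le_of_mul_le_mul_left hfin (by positivity)

end Numeric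

/-- The relative decrement `1 - v (j + 1) / v j`; it equals `1` where `v j = 0`. -/
noncomputable def decr (v : ℕ → ℝ) (j : ℕ) : ℝ := 1 - v (j + 1) / v j

/-- A monotone bounded quantity controlling the error of affine approximation of `M * v ^ 5`. -/
noncomputable def potential (M : ℝ) (v : ℕ → ℝ) (j : ℕ) : ℝ :=
  M * ∑ i ∈ Finset.range j, v i + (1 - v j) + (1 - √√(M / (M + decr v j)))

section Sequence

variable {M η : ℝ} {v : ℕ → ℝ}

lemma ratio_le_one (h0 : ∀ j, 0 ≤ v j) (ha : Antitone v) (j : ℕ) : v (j + 1) / v j ≤ 1 :=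
  div_le_one_of_le₀ (ha (Nat.le_succ j)) (h0 j)

lemma decr_nonneg (h0 : ∀ j, 0 ≤ v j) (ha : Antitone v) (j : ℕ) : 0 ≤ decr v j :=
  sub_nonneg.2 (ratio_le_one h0 ha j)

lemma decr_le_one (h0 : ∀ j, 0 ≤ v j) (j : ℕ) : decr v j ≤ 1 :=
  sub_le_self _ (div_nonneg (h0 _) (h0 _))

lemma mul_ratio (h0 : ∀ j, 0 ≤ v j) (ha : Antitone v) (j : ℕ) :
    v j * (v (j + 1) / v j) = v (j + 1) := by
  rcases (h0 j).eq_or_lt with h | h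
  · rw [← h, zero_mul]
    exact ((h0 _).antisymm (h ▸ ha (Nat.le_succ j)))
  · exact mul_div_cancel₀ _ h.ne'

lemma mul_decr (h0 : ∀ j, 0 ≤ v j) (ha : Antitone v) (j : ℕ) :
    v j * decr v j = v j - v (j + 1) := by
  rw [decr, mul_sub, mul_one, mul_ratio h0 ha]

lemma ratio_antitone (h0 : ∀ j, 0 ≤ v j) (ha : Antitone v)
    (hlc : ∀ j, v j * v (j + 2) ≤ v (j + 1) ^ 2) : Antitone fun j => v (j + 1) / v j := by
  refine antitone_nat_of_succ_le fun j => ?_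
  rcases (h0 (j + 1)).eq_or_lt with h | h
  · simp [← h]
  · have hj : 0 < v j := h.trans_le (ha (Nat.le_succ j))
    rw [div_le_div_iff₀ h hj]
    nlinarith [hlc j]

lemma decr_monotone (h0 : ∀ j, 0 ≤ v j) (ha : Antitone v)
    (hlc : ∀ j, v j * v (j + 2) ≤ v (j + 1) ^ 2) : Monotone (decr v) :=
  fun _ _ h => sub_le_sub_left (ratio_antitone h0 ha hlc h) 1

lemma add_le_mul (h0 : ∀ j, 0 ≤ v j) (ha : Antitone v)
    (hlc : ∀ j, v j * v (j + 2) ≤ v (j + 1) ^ 2) (h1 : v 0 = 1) (L j : ℕ) :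
    v (j + L) ≤ v j * v L := by
  induction j with
  | zero => simp [h1]
  | succ j ih =>
    calc v (j + 1 + L) = v (j + L) * (v (j + L + 1) / v (j + L)) := by
          rw [mul_ratio h0 ha]; congr 1; omega
      _ ≤ v j * v L * (v (j + 1) / v j) := by
          refine mul_le_mul ih (ratio_antitone h0 ha hlc (Nat.le_add_right j L))
            (div_nonneg (h0 _) (h0 _)) (mul_nonneg (h0 _) (h0 _))
      _ = v j * (v (j + 1) / v j) * v L := by ring
      _ = v (j + 1) * v L := by rw [mul_ratio h0 ha]

/-- If `M * v ^ 5` has total mass at most one, then `M * v` has bounded mass. -/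
lemma mul_sum_le (hM : 0 < M) (hM1 : M ≤ 1) (h0 : ∀ j, 0 ≤ v j) (ha : Antitone v)
    (hlc : ∀ j, v j * v (j + 2) ≤ v (j + 1) ^ 2) (h1 : v 0 = 1)
    (hs : ∀ n, ∑ j ∈ Finset.range n, M * v j ^ 5 ≤ 1) (n : ℕ) :
    M * ∑ j ∈ Finset.range n, v j ≤ 66 := by
  set L := ⌈32 / M⌉₊ with hL
  have hL1 : 32 ≤ M * L := by
    have := Nat.le_ceil (32 / M)
    rw [div_le_iff₀ hM] at this
    linarith
  have hL2 : M * L ≤ 33 := by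
    have := (Nat.ceil_lt_add_one (show 0 ≤ 32 / M by positivity)).le
    have h2 : M * L ≤ M * (32 / M + 1) := by gcongr
    rw [mul_add, mul_div_cancel₀ _ hM.ne'] at h2
    linarith
  have hvL : v L ≤ 1 / 2 := by
    have h2 : L * (M * v L ^ 5) ≤ 1 := by
      calc L * (M * v L ^ 5) = ∑ _j ∈ Finset.range L, M * v L ^ 5 := by simp
        _ ≤ ∑ j ∈ Finset.range L, M * v j ^ 5 := by
            refine Finset.sum_le_sum fun j hj => ?_
            have := ha (Finset.mem_range.1 hj).le
            have := h0 L
            gcongr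
        _ ≤ 1 := hs L
    have h3 : 32 * v L ^ 5 ≤ 1 := by
      have : 0 ≤ v L ^ 5 := pow_nonneg (h0 L) 5
      nlinarith
    by_contra! h
    have : (1 / 2 : ℝ) ^ 5 < v L ^ 5 := by gcongr
    linarith
  have hT : ∑ j ∈ Finset.range n, v j ≤ L + (1 / 2) * ∑ j ∈ Finset.range n, v j := by
    calc ∑ j ∈ Finset.range n, v j ≤ ∑ j ∈ Finset.range (L + n), v j :=
          Finset.sum_le_sum_of_subset_of_nonneg
            (Finset.range_subset_range.2 (by omega)) fun j _ _ => h0 j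
      _ = ∑ j ∈ Finset.range L, v j + ∑ j ∈ Finset.range n, v (L + j) :=
          Finset.sum_range_add _ _ _
      _ ≤ ∑ _j ∈ Finset.range L, 1 + ∑ j ∈ Finset.range n, (1 / 2) * v j := by
          refine add_le_add (Finset.sum_le_sum fun j _ => h1 ▸ ha (Nat.zero_le j))
            (Finset.sum_le_sum fun j _ => ?_)
          have h2 := add_le_mul h0 ha hlc h1 L j
          have h3 : v j * v L ≤ v j * (1 / 2) := mul_le_mul_of_nonneg_left hvL (h0 j)
          rw [add_comm L j]
          linarith
      _ = _ := by simp [Finset.mul_sum]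
  have : M * ∑ j ∈ Finset.range n, v j ≤ M * (2 * L) := by gcongr; linarith
  linarith

lemma slope_div_pos (hM : 0 < M) (h0 : ∀ j, 0 ≤ v j) (ha : Antitone v) (j : ℕ) :
    0 < M / (M + decr v j) :=
  div_pos hM (add_pos_of_pos_of_nonneg hM (decr_nonneg h0 ha j))

lemma slope_div_antitone (hM : 0 < M) (h0 : ∀ j, 0 ≤ v j) (ha : Antitone v)
    (hlc : ∀ j, v j * v (j + 2) ≤ v (j + 1) ^ 2) :
    Antitone fun j => √√(M / (M + decr v j)) := by
  intro i j hij
  have h1 := decr_nonneg h0 ha i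
  have h2 := decr_monotone h0 ha hlc hij
  dsimp only
  gcongr

lemma slope_div_le_one (hM : 0 < M) (h0 : ∀ j, 0 ≤ v j) (ha : Antitone v) (j : ℕ) :
    √√(M / (M + decr v j)) ≤ 1 := by
  have h1 := decr_nonneg h0 ha j
  rw [Real.sqrt_le_one, Real.sqrt_le_one]
  exact div_le_one_of_le₀ (by linarith) (by linarith)

lemma slope_div_pow (hM : 0 < M) (h0 : ∀ j, 0 ≤ v j) (ha : Antitone v) (j : ℕ) :
    √√(M / (M + decr v j)) ^ 4 * (M + decr v j) = M := by
  have h1 := decr_nonneg h0 ha j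
  have h2 : √√(M / (M + decr v j)) ^ 4 = M / (M + decr v j) := by
    rw [show 4 = 2 * 2 from rfl, pow_mul, Real.sq_sqrt (Real.sqrt_nonneg _),
      Real.sq_sqrt (slope_div_pos hM h0 ha j).le]
  rw [h2, div_mul_cancel₀]
  linarith

lemma potential_sub_le (hM : 0 < M) (hM1 : M ≤ 1) (h0 : ∀ j, 0 ≤ v j) (ha : Antitone v)
    (hlc : ∀ j, v j * v (j + 2) ≤ v (j + 1) ^ 2) (h1 : v 0 = 1)
    (hs : ∀ n, ∑ j ∈ Finset.range n, M * v j ^ 5 ≤ 1) (n : ℕ) :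
    potential M v n - potential M v 0 ≤ 68 := by
  have h2 := mul_sum_le hM hM1 h0 ha hlc h1 hs n
  have h3 := h0 n
  have h4 := slope_div_le_one hM h0 ha 0
  have h5 := Real.sqrt_nonneg √(M / (M + decr v n))
  simp only [potential, Finset.range_zero, Finset.sum_empty, h1]
  linarith

end Sequence

section Piece

/-- A sequence with controlled decrements lies between two lines through its last point. -/
lemma sub_bounds {q : ℕ → ℝ} {x w : ℕ} {l h : ℝ}
    (hd : ∀ j, x ≤ j → j < x + w → l ≤ q j - q (j + 1) ∧ q j - q (j + 1) ≤ h) {j : ℕ}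
    (hxj : x ≤ j) (hj : j ≤ x + w) :
    q (x + w) + l * ((x + w : ℕ) - j : ℝ) ≤ q j ∧
      q j ≤ q (x + w) + h * ((x + w : ℕ) - j : ℝ) := by
  induction hj using Nat.decreasingInduction with
  | self => simp
  | of_succ k hk ih =>
    obtain ⟨h1, h2⟩ := ih (by omega)
    obtain ⟨h3, h4⟩ := hd k hxj hk
    rw [Nat.cast_succ] at h1 h2
    constructor <;> linarith

lemma line_error_le {q : ℕ → ℝ} {x w : ℕ} {l h s : ℝ} (hl : 0 ≤ l) (hs : l ≤ s) (hs' : s ≤ h)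
    (hq : 0 ≤ q (x + w))
    (hd : ∀ j, x ≤ j → j < x + w → l ≤ q j - q (j + 1) ∧ q j - q (j + 1) ≤ h) {j : ℕ}
    (hxj : x ≤ j) (hj : j ≤ x + w) :
    0 ≤ q (x + w) + s * ((x + w : ℕ) - j : ℝ) ∧
      q (x + w) * (√(q j) - √(q (x + w) + s * ((x + w : ℕ) - j : ℝ))) ^ 2 ≤ (w * (h - l)) ^ 2 := by
  obtain ⟨h1, h2⟩ := sub_bounds hd hxj hj
  have hk : (0 : ℝ) ≤ (x + w : ℕ) - j := sub_nonneg.2 (by exact_mod_cast hj)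
  have hkw : ((x + w : ℕ) - j : ℝ) ≤ w := by
    have : (x : ℝ) ≤ j := by exact_mod_cast hxj
    push_cast
    linarith
  have hnn : 0 ≤ q (x + w) + s * ((x + w : ℕ) - j : ℝ) :=
    add_nonneg hq (mul_nonneg (hl.trans hs) hk)
  have hqj : q (x + w) ≤ q j := le_trans (le_add_of_nonneg_right (mul_nonneg hl hk)) h1
  refine ⟨hnn, (mul_sqrt_sub_sqrt_sq_le hq hqj hnn).trans ?_⟩
  refine sq_le_sq' ?_ ?_ <;> nlinarith

variable {M η : ℝ} {v : ℕ → ℝ}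

lemma potential_sub_bounds (hM : 0 < M) (h0 : ∀ j, 0 ≤ v j) (ha : Antitone v)
    (hlc : ∀ j, v j * v (j + 2) ≤ v (j + 1) ^ 2) {x w : ℕ}
    (hΦ : potential M v (x + w) - potential M v x ≤ η) :
    w * M * v (x + w) ≤ η ∧ v x - v (x + w) ≤ η ∧
      √√(M / (M + decr v x)) - √√(M / (M + decr v (x + w))) ≤ η := by
  have h1 := slope_div_antitone hM h0 ha hlc (Nat.le_add_right x w)
  have h2 := ha (Nat.le_add_right x w)
  have h3 : w * M * v (x + w) ≤
      M * ∑ i ∈ Finset.range (x + w), v i - M * ∑ i ∈ Finset.range x, v i := by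
    rw [Finset.sum_range_add, mul_add, add_sub_cancel_left, mul_comm (w : ℝ), mul_assoc]
    refine mul_le_mul_of_nonneg_left ?_ hM.le
    calc w * v (x + w) = ∑ _i ∈ Finset.range w, v (x + w) := by simp
      _ ≤ _ := Finset.sum_le_sum fun i hi => ha (by have := Finset.mem_range.1 hi; omega)
  have h4 : 0 ≤ w * M * v (x + w) := by have := h0 (x + w); positivity
  simp only [potential] at hΦ
  dsimp only at h1
  refine ⟨?_, ?_, ?_⟩ <;> linarith

lemma sub_eq_sum_mul_decr (h0 : ∀ j, 0 ≤ v j) (ha : Antitone v) (x w : ℕ) :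
    v x - v (x + w) = ∑ i ∈ Finset.range w, v (x + i) * decr v (x + i) := by
  simp only [mul_decr h0 ha]
  exact (Finset.sum_range_sub' (fun i => v (x + i)) w).symm

lemma mul_decr_mul_le (h0 : ∀ j, 0 ≤ v j) (ha : Antitone v)
    (hlc : ∀ j, v j * v (j + 2) ≤ v (j + 1) ^ 2) (x w : ℕ) :
    w * decr v x * v (x + w) ≤ v x - v (x + w) := by
  rw [sub_eq_sum_mul_decr h0 ha]
  calc w * decr v x * v (x + w) = ∑ _i ∈ Finset.range w, v (x + w) * decr v x := by
        simp; ring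
    _ ≤ _ := Finset.sum_le_sum fun i hi =>
        mul_le_mul (ha (by have := Finset.mem_range.1 hi; omega))
          (decr_monotone h0 ha hlc (Nat.le_add_right x i)) (decr_nonneg h0 ha x) (h0 _)

lemma sub_le_mul_decr (h0 : ∀ j, 0 ≤ v j) (ha : Antitone v)
    (hlc : ∀ j, v j * v (j + 2) ≤ v (j + 1) ^ 2) (x w : ℕ) :
    v x - v (x + w) ≤ w * v x * decr v (x + w) := by
  rw [sub_eq_sum_mul_decr h0 ha]
  calc _ ≤ ∑ _i ∈ Finset.range w, v x * decr v (x + w) := Finset.sum_le_sum fun i hi =>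
        mul_le_mul (ha (Nat.le_add_right x i))
          (decr_monotone h0 ha hlc (by have := Finset.mem_range.1 hi; omega))
          (decr_nonneg h0 ha _) (h0 _)
    _ = _ := by simp; ring

lemma pow_sub_pow_eq (h0 : ∀ j, 0 ≤ v j) (ha : Antitone v) (j : ℕ) :
    M * v j ^ 5 - M * v (j + 1) ^ 5 = M * v j ^ 5 * (1 - (1 - decr v j) ^ 5) := by
  have : v (j + 1) = v j * (1 - decr v j) := by rw [mul_one_sub, mul_decr h0 ha]; ring
  rw [this]
  ring

/-- On an interval across which the potential increases by at most `η`, the sequence `M * v ^ 5`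
is bounded below and above by affine functions with Hellinger error `O(η ^ 5)`. -/
lemma exists_affine_on_piece (hM : 0 < M) (h0 : ∀ j, 0 ≤ v j) (ha : Antitone v)
    (hlc : ∀ j, v j * v (j + 2) ≤ v (j + 1) ^ 2) (h1 : v 0 = 1) (hη : 0 < η) {x w : ℕ}
    (hΦ : potential M v (x + w) - potential M v x ≤ η) (hv : η ≤ v (x + w)) :
    ∃ α β α' β' : ℝ, ∀ j, x ≤ j → j ≤ x + w →
      (0 ≤ α * j + β ∧ α * j + β ≤ M * v j ^ 5 ∧ M * v j ^ 5 ≤ α' * j + β') ∧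
      (w + 1) * (√(M * v j ^ 5) - √(α * j + β)) ^ 2 ≤ 15099494400 * η ^ 5 ∧
      (w + 1) * (√(M * v j ^ 5) - √(α' * j + β')) ^ 2 ≤ 15099494400 * η ^ 5 := by
  have hV' : 0 < v (x + w) := hη.trans_le hv
  have hV'V : v (x + w) ≤ v x := ha (Nat.le_add_right x w)
  have hV1 : v x ≤ 1 := h1 ▸ ha (Nat.zero_le x)
  rcases Nat.eq_zero_or_pos w with rfl | hw
  · refine ⟨0, M * v x ^ 5, 0, M * v x ^ 5, fun j hj hj' => ?_⟩
    obtain rfl : j = x := by omega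
    have : 0 ≤ M * v j ^ 5 := mul_nonneg hM.le (pow_nonneg (h0 j) 5)
    have : 0 ≤ 15099494400 * η ^ 5 := by positivity
    simp [*]
  have hw1 : (1 : ℝ) ≤ w := by exact_mod_cast hw
  obtain ⟨hwM, hd, hz⟩ := potential_sub_bounds hM h0 ha hlc hΦ
  have hVV : v x ≤ 2 * v (x + w) := by linarith
  have hwu := (mul_decr_mul_le h0 ha hlc x w).trans hd
  have hu₁ := decr_nonneg h0 ha x
  have hu := decr_monotone h0 ha hlc (Nat.le_add_right x w)
  have hz₁ := slope_div_pow hM h0 ha x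
  have hz₂ := slope_div_pow hM h0 ha (x + w)
  have hz₂p : 0 < √√(M / (M + decr v (x + w))) :=
    Real.sqrt_pos.2 (Real.sqrt_pos.2 (slope_div_pos hM h0 ha _))
  by_cases hzz : √√(M / (M + decr v x)) ≤ 2 * √√(M / (M + decr v (x + w)))
  · set l := M * v (x + w) ^ 5 * (1 - (1 - decr v x) ^ 5) with hl
    set h := M * v x ^ 5 * (1 - (1 - decr v (x + w)) ^ 5) with hh
    have hu₂ := decr_le_one h0 (x + w)
    have herr := affine_error_le hM hV' hV'V hV1 hVV hu₁ hu hu₂ hz₂p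
      (slope_div_antitone hM h0 ha hlc (Nat.le_add_right x w)) (slope_div_le_one hM h0 ha x) hzz hz
      hz₁ hz₂ hw1 hwM hwu (sub_le_mul_decr h0 ha hlc x w)
    rw [← hh, ← hl] at herr
    have hdec : ∀ j, x ≤ j → j < x + w →
        l ≤ M * v j ^ 5 - M * v (j + 1) ^ 5 ∧ M * v j ^ 5 - M * v (j + 1) ^ 5 ≤ h := by
      intro j hxj hj
      rw [pow_sub_pow_eq h0 ha]
      have e1 := ha hxj
      have e2 := ha hj.le
      have e3 := decr_monotone h0 ha hlc hxj
      have e4 := decr_monotone h0 ha hlc hj.le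
      have e5 := h0 j
      have e6 : 0 ≤ 1 - (1 - decr v x) ^ 5 :=
        sub_nonneg.2 (pow_le_one₀ (by linarith) (by linarith))
      have e7 : 1 - (1 - decr v x) ^ 5 ≤ 1 - (1 - decr v j) ^ 5 := by
        gcongr
        linarith
      have e8 : 1 - (1 - decr v j) ^ 5 ≤ 1 - (1 - decr v (x + w)) ^ 5 := by
        gcongr
      constructor
      · rw [hl]; gcongr
      · have e9 : 0 ≤ M * v x ^ 5 := mul_nonneg hM.le (pow_nonneg (h0 x) 5)
        rw [hh]; gcongr; linarith
    have hl0 : 0 ≤ l := mul_nonneg (by positivity)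
      (sub_nonneg.2 (pow_le_one₀ (by linarith) (by linarith)))
    have hlh : l ≤ h := (hdec x le_rfl (by omega)).1.trans (hdec x le_rfl (by omega)).2
    have hq0 : 0 < M * v (x + w) ^ 5 := by positivity
    have key : ∀ s, l ≤ s → s ≤ h → ∀ j, x ≤ j → j ≤ x + w →
        0 ≤ -s * j + (M * v (x + w) ^ 5 + s * (x + w : ℕ)) ∧
        (w + 1) * (√(M * v j ^ 5) - √(-s * j + (M * v (x + w) ^ 5 + s * (x + w : ℕ)))) ^ 2 ≤
          15099494400 * η ^ 5 := by
      intro s hs hs' j hxj hj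
      obtain ⟨h2, h3⟩ :=
        line_error_le (q := fun j => M * v j ^ 5) hl0 hs hs' hq0.le hdec hxj hj
      have e : -s * j + (M * v (x + w) ^ 5 + s * (x + w : ℕ)) =
          M * v (x + w) ^ 5 + s * ((x + w : ℕ) - j : ℝ) := by ring
      rw [e]
      refine ⟨h2, le_of_mul_le_mul_left ?_ hq0⟩
      calc _ = (w + 1) * (M * v (x + w) ^ 5 * (√(M * v j ^ 5)
            - √(M * v (x + w) ^ 5 + s * ((x + w : ℕ) - j : ℝ))) ^ 2) := by ring
        _ ≤ (w + 1) * (w * (h - l)) ^ 2 := by gcongr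
        _ ≤ 15099494400 * η ^ 5 * (M * v (x + w) ^ 5) := herr
        _ = _ := by ring
    refine ⟨_, _, _, _, fun j hxj hj =>
      ⟨⟨(key l le_rfl hlh j hxj hj).1, ?_, ?_⟩, (key l le_rfl hlh j hxj hj).2,
        (key h hlh le_rfl j hxj hj).2⟩⟩
    · have := (sub_bounds (q := fun j => M * v j ^ 5) hdec hxj hj).1
      linarith
    · have := (sub_bounds (q := fun j => M * v j ^ 5) hdec hxj hj).2
      linarith
  · have herr := const_error_le hM.le (h0 x) hV1 hVV hu₁ (Real.sqrt_nonneg _)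
      (by linarith : √√(M / (M + decr v x)) ≤ 2 * η) hz₁ hw1 hwM hwu
    refine ⟨0, M * v (x + w) ^ 5, 0, M * v x ^ 5, fun j hxj hj => ?_⟩
    have e1 : M * v j ^ 5 ≤ M * v x ^ 5 := by have := ha hxj; have := h0 j; gcongr
    have e2 : M * v (x + w) ^ 5 ≤ M * v j ^ 5 := by have := ha hj; gcongr
    have e3 : 0 ≤ M * v (x + w) ^ 5 := by positivity
    have e4 : 128 * η ^ 5 ≤ 15099494400 * η ^ 5 := by gcongr; norm_num
    have key : ∀ c, 0 ≤ c → c ≤ M * v x ^ 5 →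
        (w + 1) * (√(M * v j ^ 5) - √c) ^ 2 ≤ 15099494400 * η ^ 5 := by
      intro c hc hc'
      refine le_trans ?_ (herr.trans e4)
      refine mul_le_mul_of_nonneg_left ?_ (by positivity)
      refine (sqrt_sub_sqrt_sq_le_abs (e3.trans e2) hc).trans ?_
      rw [abs_le]
      constructor <;> linarith
    simp only [zero_mul, zero_add]
    exact ⟨⟨e3, e2, e1⟩, key _ e3 (e2.trans e1), key _ ((e3.trans e2).trans e1) le_rfl⟩

end Piece

/-- `g` is a piecewise affine approximation of `q` on `{0,…,B-1}` at scale `η`, and `q` has little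
mass beyond. -/
def HalfApprox (q : ℕ → ℝ) (η : ℝ) (B : ℕ) (g : ℕ → ℝ) : Prop :=
  (∀ j, 0 ≤ g j) ∧ (∀ j, B ≤ j → g j = 0) ∧
  (∃ N : ℕ, (N : ℝ) ≤ 69 / η ∧ ∃ c : ℕ → ℕ, c 0 = 0 ∧ c N = B ∧ (∀ i < N, c i < c (i + 1)) ∧
    ∀ i < N, ∃ α β : ℝ, ∀ j, c i ≤ j → j < c (i + 1) → g j = α * j + β) ∧
  ∑' j, (if B ≤ j then q j else 0) ≤ 2000000000000 * η ^ 4 ∧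
  ∑' j, (√(q j) - √(g j)) ^ 2 ≤ 2000000000000 * η ^ 4

lemma le_of_lt_succ {c : ℕ → ℕ} {N : ℕ} (hc : ∀ i < N, c i < c (i + 1)) {i : ℕ} (hi : i ≤ N) :
    c i ≤ c N := by
  induction hi using Nat.decreasingInduction with
  | self => exact le_rfl
  | of_succ k hk ih => exact (hc k hk).le.trans ih

lemma exists_piece {c : ℕ → ℕ} (h0 : c 0 = 0) {N j : ℕ} (hj : j < c N) :
    ∃ i < N, c i ≤ j ∧ j < c (i + 1) := by
  induction N with
  | zero => omega
  | succ N ih =>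
    by_cases h : j < c N
    · obtain ⟨i, hi, h⟩ := ih h
      exact ⟨i, by omega, h⟩
    · exact ⟨N, by omega, by omega, hj⟩

lemma exists_glue {c : ℕ → ℕ} {N : ℕ} (hc : ∀ i < N, c i < c (i + 1)) (l : ℕ → ℕ → ℝ) :
    ∃ g : ℕ → ℝ, (∀ i < N, ∀ j, c i ≤ j → j < c (i + 1) → g j = l i j) ∧
      ∀ j, c N ≤ j → g j = 0 := by
  induction N with
  | zero => exact ⟨0, by simp, by simp⟩
  | succ N ih =>
    obtain ⟨g, hg, -⟩ := ih fun i hi => hc i (by omega)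
    refine ⟨fun j => if j < c N then g j else if j < c (N + 1) then l N j else 0, ?_, ?_⟩
    · intro i hi j hij hj
      rcases Nat.lt_succ_iff_lt_or_eq.1 hi with h | rfl
      · have := le_of_lt_succ (fun i hi => hc i (by omega)) (Nat.succ_le_of_lt h)
        simp only [hj.trans_le this, if_true]
        exact hg i h j hij hj
      · simp [hj, hij.not_gt]
    · intro j hj
      have := hc N (by omega)
      simp [hj.not_gt, (this.le.trans hj).not_gt]

lemma sum_range_le_of_pieces {c : ℕ → ℕ} (h0 : c 0 = 0) {N : ℕ} (hc : ∀ i < N, c i < c (i + 1))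
    {f : ℕ → ℝ} {E : ℝ}
    (hf : ∀ i < N, ∀ j, c i ≤ j → j < c (i + 1) → ((c (i + 1) - c i : ℕ) : ℝ) * f j ≤ E) :
    ∑ j ∈ Finset.range (c N), f j ≤ N * E := by
  induction N with
  | zero => simp [h0]
  | succ N ih =>
    have hN := hc N (by omega)
    rw [← Finset.sum_range_add_sum_Ico _ hN.le]
    have h1 := ih (fun i hi => hc i (by omega)) fun i hi => hf i (by omega)
    have hpos : (0 : ℝ) < ((c (N + 1) - c N : ℕ) : ℝ) := by exact_mod_cast Nat.sub_pos_of_lt hN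
    have h2 : ∑ j ∈ Finset.Ico (c N) (c (N + 1)), f j ≤ E := by
      calc _ ≤ ∑ _j ∈ Finset.Ico (c N) (c (N + 1)), E / ((c (N + 1) - c N : ℕ) : ℝ) := by
            refine Finset.sum_le_sum fun j hj => ?_
            obtain ⟨hj1, hj2⟩ := Finset.mem_Ico.1 hj
            rw [le_div_iff₀ hpos, mul_comm]
            exact hf N (by omega) j hj1 hj2
        _ = E := by
            rw [Finset.sum_const, Nat.card_Ico, nsmul_eq_mul, mul_div_cancel₀ _ hpos.ne']
    push_cast
    linarith

section Half

variable {M η : ℝ} {v : ℕ → ℝ}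

lemma tsum_le_of_tail (hM : 0 < M) (hM1 : M ≤ 1) (h0 : ∀ j, 0 ≤ v j) (ha : Antitone v)
    (hlc : ∀ j, v j * v (j + 2) ≤ v (j + 1) ^ 2) (h1 : v 0 = 1)
    (hs : ∀ n, ∑ j ∈ Finset.range n, M * v j ^ 5 ≤ 1) {B : ℕ} (hB : v B ≤ η) {f : ℕ → ℝ}
    (hf0 : ∀ j, 0 ≤ f j) (hf : ∀ j, B ≤ j → f j ≤ M * v j ^ 5) :
    ∑' j, f j ≤ ∑ j ∈ Finset.range B, f j + 66 * η ^ 4 := by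
  refine Real.tsum_le_of_sum_range_le hf0 fun n => ?_
  calc ∑ j ∈ Finset.range n, f j ≤ ∑ j ∈ Finset.range (B + n), f j :=
        Finset.sum_le_sum_of_subset_of_nonneg
          (Finset.range_subset_range.2 (by omega)) fun j _ _ => hf0 j
    _ = ∑ j ∈ Finset.range B, f j + ∑ j ∈ Finset.range n, f (B + j) := Finset.sum_range_add _ _ _
    _ ≤ ∑ j ∈ Finset.range B, f j + 66 * η ^ 4 := by
        gcongr
        calc ∑ j ∈ Finset.range n, f (B + j)
            ≤ ∑ j ∈ Finset.range n, M * v (B + j) * η ^ 4 := by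
              refine Finset.sum_le_sum fun j _ => (hf _ (Nat.le_add_right B j)).trans ?_
              have e1 := h0 (B + j)
              have e2 := (ha (Nat.le_add_right B j)).trans hB
              calc M * v (B + j) ^ 5 = M * v (B + j) * v (B + j) ^ 4 := by ring
                _ ≤ _ := by gcongr
          _ = (M * ∑ j ∈ Finset.range n, v (B + j)) * η ^ 4 := by
              rw [Finset.mul_sum, Finset.sum_mul]
          _ ≤ 66 * η ^ 4 := by
              refine mul_le_mul_of_nonneg_right ?_ (by positivity)
              refine le_trans ?_ (mul_sum_le hM hM1 h0 ha hlc h1 hs (B + n))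
              rw [Finset.sum_range_add]
              refine mul_le_mul_of_nonneg_left ?_ hM.le
              exact le_add_of_nonneg_left (Finset.sum_nonneg fun j _ => h0 j)

lemma halfApprox_of_pieces (hM : 0 < M) (hM1 : M ≤ 1) (h0 : ∀ j, 0 ≤ v j) (ha : Antitone v)
    (hlc : ∀ j, v j * v (j + 2) ≤ v (j + 1) ^ 2) (h1 : v 0 = 1)
    (hs : ∀ n, ∑ j ∈ Finset.range n, M * v j ^ 5 ≤ 1) (hη : 0 < η) {c : ℕ → ℕ} {N : ℕ}
    (hc0 : c 0 = 0) (hc : ∀ i < N, c i < c (i + 1)) (hN : N ≤ 69 / η) (hB : v (c N) ≤ η)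
    {g : ℕ → ℝ} (hg : ∀ j, c N ≤ j → g j = 0)
    (hl : ∀ i < N, ∃ α β : ℝ, ∀ j, c i ≤ j → j < c (i + 1) → g j = α * j + β ∧ 0 ≤ α * j + β ∧
      ((c (i + 1) - c i : ℕ) : ℝ) * (√(M * v j ^ 5) - √(α * j + β)) ^ 2 ≤
        15099494400 * η ^ 5) :
    HalfApprox (fun j => M * v j ^ 5) η (c N) g := by
  refine ⟨fun j => ?_, hg, ⟨N, hN, c, hc0, rfl, hc, fun i hi => ?_⟩, ?_, ?_⟩
  · by_cases hj : j < c N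
    · obtain ⟨i, hi, hij, hj⟩ := exists_piece hc0 hj
      obtain ⟨α, β, h⟩ := hl i hi
      obtain ⟨h1, h2, -⟩ := h j hij hj
      rwa [h1]
    · exact (hg j (not_lt.1 hj)).ge
  · obtain ⟨α, β, h⟩ := hl i hi
    exact ⟨α, β, fun j hij hj => (h j hij hj).1⟩
  · have hq : ∀ j, 0 ≤ M * v j ^ 5 := fun j => mul_nonneg hM.le (pow_nonneg (h0 j) 5)
    refine (tsum_le_of_tail hM hM1 h0 ha hlc h1 hs hB ?_ ?_).trans ?_
    · intro j
      split_ifs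
      exacts [hq j, le_rfl]
    · intro j hj
      simp [hj]
    · rw [Finset.sum_eq_zero]
      · have : 0 < η ^ 4 := by positivity
        linarith
      · intro j hj
        simp [(Finset.mem_range.1 hj).not_ge]
  · refine (tsum_le_of_tail hM hM1 h0 ha hlc h1 hs hB (fun j => sq_nonneg _) ?_).trans ?_
    · intro j hj
      rw [hg j hj, Real.sqrt_zero, sub_zero, Real.sq_sqrt]
      exact mul_nonneg hM.le (pow_nonneg (h0 j) 5)
    · have := sum_range_le_of_pieces (E := 15099494400 * η ^ 5) hc0 hc
        (f := fun j => (√(M * v j ^ 5) - √(g j)) ^ 2) (by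
          intro i hi j hij hj
          obtain ⟨α, β, h⟩ := hl i hi
          obtain ⟨h1, -, h2⟩ := h j hij hj
          rwa [h1])
      have h2 : N * (15099494400 * η ^ 5) ≤ 69 / η * (15099494400 * η ^ 5) := by gcongr
      have h3 : 69 / η * (15099494400 * η ^ 5) = 1041865113600 * η ^ 4 := by
        field_simp
        norm_num
      have : 0 < η ^ 4 := by positivity
      linarith

lemma exists_halfApprox_of_pow (hM : 0 < M) (hM1 : M ≤ 1) (h0 : ∀ j, 0 ≤ v j) (ha : Antitone v)
    (hlc : ∀ j, v j * v (j + 2) ≤ v (j + 1) ^ 2) (h1 : v 0 = 1)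
    (hs : ∀ n, ∑ j ∈ Finset.range n, M * v j ^ 5 ≤ 1) (hη : 0 < η) (hη1 : η < 1) :
    ∃ B, 1 ≤ B ∧ ∃ g g', HalfApprox (fun j => M * v j ^ 5) η B g ∧
      HalfApprox (fun j => M * v j ^ 5) η B g' ∧
      ∀ j < B, g j ≤ M * v j ^ 5 ∧ M * v j ^ 5 ≤ g' j := by
  classical
  have hex : ∃ n, v n < η := by
    by_contra! h
    obtain ⟨n, hn⟩ := exists_nat_gt (66 / (M * η))
    rw [div_lt_iff₀ (by positivity)] at hn
    have h2 := mul_sum_le hM hM1 h0 ha hlc h1 hs n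
    have h3 : n * η ≤ ∑ j ∈ Finset.range n, v j := by
      calc n * η = ∑ _j ∈ Finset.range n, η := by simp
        _ ≤ _ := Finset.sum_le_sum fun j _ => h j
    have h4 := mul_le_mul_of_nonneg_left h3 hM.le
    linarith
  obtain ⟨B, hB⟩ : ∃ B, Nat.find hex = B + 1 := by
    refine Nat.exists_eq_add_one_of_ne_zero fun h => ?_
    have := Nat.find_spec hex
    rw [h, h1] at this
    linarith
  have hvB : v (B + 1) ≤ η := hB ▸ (Nat.find_spec hex).le
  have hv : ∀ j ≤ B, η ≤ v j := fun j hj => not_lt.1 (Nat.find_min hex (by omega))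
  obtain ⟨N, c, hc0, hcN, hc, hsp, hcount⟩ :=
    exists_partition_of_oscillation (potential M v) hη.le B
  have hN : ((N + 1 : ℕ) : ℝ) ≤ 69 / η := by
    have := potential_sub_le hM hM1 h0 ha hlc h1 hs (c N)
    rw [le_div_iff₀ hη]
    push_cast
    linarith
  have hpiece : ∀ i < N + 1, ∃ α β α' β' : ℝ, ∀ j, c i ≤ j → j < c (i + 1) →
      (0 ≤ α * j + β ∧ α * j + β ≤ M * v j ^ 5 ∧ M * v j ^ 5 ≤ α' * j + β') ∧
      ((c (i + 1) - c i : ℕ) : ℝ) * (√(M * v j ^ 5) - √(α * j + β)) ^ 2 ≤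
        15099494400 * η ^ 5 ∧
      ((c (i + 1) - c i : ℕ) : ℝ) * (√(M * v j ^ 5) - √(α' * j + β')) ^ 2 ≤
        15099494400 * η ^ 5 := by
    intro i hi
    have hlt := hc i hi
    have hle : c (i + 1) ≤ B + 1 := hcN ▸ le_of_lt_succ hc (by omega)
    obtain ⟨w, hw⟩ : ∃ w, c (i + 1) = c i + w + 1 := ⟨c (i + 1) - c i - 1, by omega⟩
    have hsp' := hsp i hi
    rw [hw, Nat.add_sub_cancel] at hsp'
    obtain ⟨α, β, α', β', h⟩ :=
      exists_affine_on_piece hM h0 ha hlc h1 hη hsp' (hv _ (by omega))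
    refine ⟨α, β, α', β', fun j hij hj => ?_⟩
    have e : ((c (i + 1) - c i : ℕ) : ℝ) = w + 1 := by
      rw [hw, add_assoc, Nat.add_sub_cancel_left]
      push_cast
      ring
    rw [e]
    exact h j hij (by omega)
  choose! α β α' β' h using hpiece
  obtain ⟨g, hg, hg0⟩ := exists_glue hc fun i j => α i * j + β i
  obtain ⟨g', hg', hg0'⟩ := exists_glue hc fun i j => α' i * j + β' i
  refine ⟨c (N + 1), by omega, g, g', ?_, ?_, fun j hj => ?_⟩
  · refine halfApprox_of_pieces hM hM1 h0 ha hlc h1 hs hη hc0 hc hN (hcN ▸ hvB) hg0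
      fun i hi => ⟨α i, β i, fun j hij hj => ?_⟩
    obtain ⟨⟨e1, -, -⟩, e2, -⟩ := h i hi j hij hj
    exact ⟨hg i hi j hij hj, e1, e2⟩
  · refine halfApprox_of_pieces hM hM1 h0 ha hlc h1 hs hη hc0 hc hN (hcN ▸ hvB) hg0'
      fun i hi => ⟨α' i, β' i, fun j hij hj => ?_⟩
    obtain ⟨⟨e1, e3, e4⟩, -, e2⟩ := h i hi j hij hj
    exact ⟨hg' i hi j hij hj, (e1.trans e3).trans e4, e2⟩
  · obtain ⟨i, hi, hij, hj⟩ := exists_piece hc0 hj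
    rw [hg i hi j hij hj, hg' i hi j hij hj]
    exact (h i hi j hij hj).1.2

lemma exists_halfApprox {q : ℕ → ℝ} (h0 : ∀ j, 0 ≤ q j) (ha : Antitone q)
    (hlc : ∀ j, q j * q (j + 2) ≤ q (j + 1) ^ 2)
    (hs : ∀ n, ∑ j ∈ Finset.range n, q j ≤ 1) (hη : 0 < η) (hη1 : η < 1) :
    ∃ B, (0 < q 0 → 1 ≤ B) ∧ ∃ g g', HalfApprox q η B g ∧ HalfApprox q η B g' ∧
      ∀ j < B, g j ≤ q j ∧ q j ≤ g' j := by
  rcases (h0 0).eq_or_lt with h | hM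
  · have hq : q = 0 := funext fun j => le_antisymm ((ha (Nat.zero_le j)).trans h.ge) (h0 j)
    have : HalfApprox q η 0 0 := by
      subst hq
      exact ⟨fun _ => le_rfl, fun _ _ => rfl,
        ⟨0, by simpa using (div_pos (by norm_num) hη).le, fun _ => 0, rfl, rfl, by simp, by simp⟩,
        by simpa using pow_nonneg hη.le 4, by simpa using pow_nonneg hη.le 4⟩
    exact ⟨0, fun h' => absurd h h'.ne, 0, 0, this, this, by simp⟩
  · set v : ℕ → ℝ := fun j => (q j / q 0) ^ (1 / 5 : ℝ) with hv
    have hd : ∀ j, 0 ≤ q j / q 0 := fun j => div_nonneg (h0 j) hM.le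
    have hv5 : ∀ j, v j ^ 5 = q j / q 0 := fun j => by
      rw [hv]
      rw [← Real.rpow_natCast, ← Real.rpow_mul (hd j)]
      norm_num
    have hv0 : ∀ j, 0 ≤ v j := fun j => Real.rpow_nonneg (hd j) _
    have hq : ∀ j, q 0 * v j ^ 5 = q j := fun j => by rw [hv5, mul_div_cancel₀ _ hM.ne']
    have hva : Antitone v := fun i j hij => by
      have := ha hij
      have := hd j
      change (q j / q 0) ^ (1 / 5 : ℝ) ≤ (q i / q 0) ^ (1 / 5 : ℝ)
      gcongr
    have hvlc : ∀ j, v j * v (j + 2) ≤ v (j + 1) ^ 2 := fun j => by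
      refine le_of_pow_le_pow_left₀ (n := 5) (by norm_num) (sq_nonneg _) ?_
      rw [mul_pow, ← pow_mul, mul_comm 2 5, pow_mul, hv5, hv5, hv5, div_mul_div_comm, div_pow, ← sq]
      have := hlc j
      gcongr
    have hv1 : v 0 = 1 := by simp [hv, div_self hM.ne']
    obtain ⟨B, hB, g, g', h⟩ := exists_halfApprox_of_pow hM (by simpa using hs 1) hv0 hva hvlc hv1
      (by simpa only [hq] using hs) hη hη1
    simp only [hq] at h
    exact ⟨B, fun _ => hB, g, g', h⟩

end Half

section Integers

lemma exists_mode {P : ℤ → ℝ} (hP : IsDistr P) : ∃ m, 0 < P m ∧ ∀ j, P j ≤ P m := by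
  obtain ⟨i, hi⟩ : ∃ i, 0 < P i := by
    by_contra! h
    have : P = 0 := funext fun j => (h j).antisymm (hP.1 j)
    have h1 := hP.2
    rw [this] at h1
    exact zero_ne_one (hasSum_zero.unique h1)
  have hfin : {j | P i ≤ P j}.Finite := by
    have := (hP.2.summable.tendsto_cofinite_zero).eventually_lt_const hi
    simpa only [Filter.eventually_cofinite, not_lt] using this
  obtain ⟨m, hm, hmax⟩ := Set.exists_max_image _ P hfin ⟨i, le_refl (P i)⟩
  refine ⟨m, hi.trans_le hm, fun j => ?_⟩
  by_cases h : P i ≤ P j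
  · exact hmax j h
  · exact (not_le.1 h).le.trans hm

lemma IsLogConcave.antitone_right {P : ℤ → ℝ} (hP : IsLogConcave P) (h0 : ∀ j, 0 ≤ P j) {m : ℤ}
    (hm : 0 < P m) (hmax : ∀ j, P j ≤ P m) : Antitone fun j : ℕ => P (m + j) := by
  refine antitone_nat_of_succ_le fun j => ?_
  induction j with
  | zero => simpa using hmax _
  | succ j ih =>
    have hlc := hP.2 (m + (j + 1 : ℕ))
    have e1 : m + ((j + 1 : ℕ) : ℤ) - 1 = m + j := by push_cast; ring
    have e2 : m + ((j + 1 : ℕ) : ℤ) + 1 = m + (j + 1 + 1 : ℕ) := by push_cast; ring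
    rw [e1, e2] at hlc
    rcases (h0 (m + (j + 1 : ℕ))).eq_or_lt with h | h
    · rcases (h0 (m + (j + 1 + 1 : ℕ))).eq_or_lt with h' | h'
      · rw [← h, ← h']
      · exact absurd h (hP.1 m _ (m + (j + 1 + 1 : ℕ)) (by push_cast; omega) (by push_cast; omega)
          (mul_pos hm h')).ne
    · nlinarith [h0 (m + (j + 1 + 1 : ℕ))]

lemma IsLogConcave.comp_neg {P : ℤ → ℝ} (hP : IsLogConcave P) :
    IsLogConcave fun j => P (-j) := by
  refine ⟨fun i j l hij hjl h => hP.1 (-l) (-j) (-i) (by omega) (by omega) (by rwa [mul_comm]),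
    fun j => ?_⟩
  have := hP.2 (-j)
  rw [mul_comm]
  convert this using 3 <;> ring_nf

lemma tsum_int_eq_add {f : ℤ → ℝ} (hf : Summable f) (m : ℤ) :
    ∑' j, f j = ∑' n : ℕ, f (m + n) + ∑' n : ℕ, f (m - 1 - n) := by
  have h := (Equiv.addLeft m).summable_iff.2 hf
  rw [← (Equiv.addLeft m).tsum_eq f]
  have h1 : Summable fun n : ℕ => f (m + n) :=
    h.comp_injective (i := fun n : ℕ => (n : ℤ)) Nat.cast_injective
  have h2 : Summable fun n : ℕ => f (m + -(n + 1)) :=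
    h.comp_injective (i := fun n : ℕ => -((n : ℤ) + 1)) fun a b hab => by
      dsimp only at hab
      omega
  rw [tsum_of_nat_of_neg_add_one (f := fun j => f (Equiv.addLeft m j)) h1 h2]
  simp only [Equiv.coe_addLeft]
  congr 2
  funext n
  congr 1
  ring

/-- The function on `ℤ` equal to `g` to the right of `m` and to `g'`, read leftwards, to the left
of `m`. -/
noncomputable def joinAt (m : ℤ) (g g' : ℕ → ℝ) (j : ℤ) : ℝ :=
  if m ≤ j then g (j - m).toNat else g' (m - 1 - j).toNat

lemma joinAt_add (m : ℤ) (g g' : ℕ → ℝ) (n : ℕ) : joinAt m g g' (m + n) = g n := by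
  simp [joinAt]

lemma joinAt_sub (m : ℤ) (g g' : ℕ → ℝ) (n : ℕ) : joinAt m g g' (m - 1 - n) = g' n := by
  have h : ¬ m ≤ m - 1 - n := by omega
  simp [joinAt, h]

lemma eq_add_or_eq_sub (m j : ℤ) : (∃ n : ℕ, j = m + n) ∨ ∃ n : ℕ, j = m - 1 - n := by
  rcases le_or_gt m j with h | h
  · exact Or.inl ⟨(j - m).toNat, by omega⟩
  · exact Or.inr ⟨(m - 1 - j).toNat, by omega⟩

lemma goodApprox_joinAt {P : ℤ → ℝ} (hP : IsDistr P) {ε η : ℝ} (hε : 0 < ε)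
    (hη : η = √ε / 10000) {m : ℤ} {B B' : ℕ} {g g' : ℕ → ℝ}
    (hR : HalfApprox (fun n => P (m + n)) η B g)
    (hL : HalfApprox (fun n => P (m - 1 - n)) η B' g') :
    GoodApprox 2000000 P ε (joinAt m g g') (m - B') (m + B - 1) := by
  obtain ⟨h0, hz, ⟨N, hN, c, hc0, hcN, hc, hl⟩, ht, he⟩ := hR
  obtain ⟨h0', hz', ⟨N', hN', c', hc0', hcN', hc', hl'⟩, ht', he'⟩ := hL
  have hsε : 0 < √ε := Real.sqrt_pos.2 hε
  have hη4 : η ^ 4 = ε ^ 2 / 10000000000000000 := by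
    rw [hη, div_pow, show 4 = 2 * 2 from rfl, pow_mul, Real.sq_sqrt hε.le]
    norm_num
  have hnn : ∀ j, 0 ≤ joinAt m g g' j := fun j => by
    unfold joinAt
    split_ifs
    exacts [h0 _, h0' _]
  have hout : ∀ j : ℤ, (j < m - B' ∨ m + B - 1 < j) → joinAt m g g' j = 0 := fun j hj => by
    rcases eq_add_or_eq_sub m j with ⟨n, rfl⟩ | ⟨n, rfl⟩
    · rw [joinAt_add]
      exact hz n (by omega)
    · rw [joinAt_sub]
      exact hz' n (by omega)
  have hsum : Summable (joinAt m g g') :=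
    summable_of_ne_finset_zero (s := Finset.Icc (m - B' : ℤ) (m + B - 1)) fun j hj =>
      hout j (by rw [Finset.mem_Icc] at hj; omega)
  have hPs := hP.2.summable
  refine ⟨hnn, hsum, ⟨N' + N, ?_, fun i => if i ≤ N' then m - c' (N' - i) else m + c (i - N'),
    ?_, ?_, ?_, ?_⟩, hout, ?_, ?_⟩
  · have e : 69 / η = 690000 / √ε := by rw [hη]; field_simp; norm_num
    rw [e] at hN hN'
    have e2 : 690000 / √ε + 690000 / √ε ≤ 2000000 / √ε := by
      rw [← add_div]
      gcongr
      norm_num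
    push_cast
    linarith
  · simp [hcN']
  · rcases Nat.eq_zero_or_pos N with rfl | h
    · have : B = 0 := by omega
      simp [hc0', this]
    · have : ¬ N' + N ≤ N' := by omega
      simp [this, hcN]
  · intro i hi
    rcases lt_trichotomy i N' with h | rfl | h
    · have h2 := hc' (N' - (i + 1)) (by omega)
      rw [show N' - (i + 1) + 1 = N' - i by omega] at h2
      simp only [h.le, Nat.succ_le_of_lt h, if_true]
      omega
    · have h2 := hc 0 (by omega)
      simp only [le_refl, if_true, Nat.sub_self, hc0', Nat.not_succ_le_self, if_false,
        Nat.add_sub_cancel_left]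
      simp only [zero_add, hc0] at h2
      push_cast
      omega
    · have h2 := hc (i - N') (by omega)
      rw [show i - N' + 1 = i + 1 - N' by omega] at h2
      simp only [h.not_ge, (h.trans (Nat.lt_succ_self i)).not_ge, if_false]
      omega
  · intro i hi
    have hright : N' ≤ i → ∃ α β : ℝ, ∀ j : ℤ, m + (c (i - N') : ℤ) ≤ j →
        j < m + (c (i + 1 - N') : ℤ) → joinAt m g g' j = α * j + β := fun h => by
      obtain ⟨α, β, hαβ⟩ := hl (i - N') (by omega)
      refine ⟨α, β - α * m, fun j hj1 hj2 => ?_⟩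
      obtain ⟨n, rfl⟩ : ∃ n : ℕ, j = m + n := ⟨(j - m).toNat, by omega⟩
      rw [joinAt_add, hαβ n (by omega) (by rw [← Nat.sub_add_comm h]; omega)]
      push_cast
      ring
    rcases lt_trichotomy i N' with h | rfl | h
    · obtain ⟨α, β, hαβ⟩ := hl' (N' - (i + 1)) (by omega)
      rw [show N' - (i + 1) + 1 = N' - i by omega] at hαβ
      refine ⟨-α, β + α * (m - 1), fun j hj1 hj2 => ?_⟩
      simp only [h.le, Nat.succ_le_of_lt h, if_true] at hj1 hj2
      obtain ⟨n, rfl⟩ : ∃ n : ℕ, j = m - 1 - n := ⟨(m - 1 - j).toNat, by omega⟩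
      rw [joinAt_sub, hαβ n (by omega) (by omega)]
      push_cast
      ring
    · simpa [hc0, hc0'] using hright le_rfl
    · simpa only [h.not_ge, (h.trans (Nat.lt_succ_self i)).not_ge, if_false] using hright h.le
  · have hs : Summable fun j : ℤ => if j < m - B' ∨ m + B - 1 < j then P j else 0 := by
      refine Summable.of_nonneg_of_le (fun j => ?_) (fun j => ?_) hPs
      · split_ifs
        exacts [hP.1 j, le_rfl]
      · split_ifs
        exacts [le_rfl, hP.1 j]
    rw [tsum_int_eq_add hs m]
    have e1 : ∀ n : ℕ, (m + (n : ℤ) < m - B' ∨ m + (B : ℤ) - 1 < m + n) ↔ B ≤ n := by omega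
    have e2 : ∀ n : ℕ, (m - 1 - (n : ℤ) < m - B' ∨ m + (B : ℤ) - 1 < m - 1 - n) ↔ B' ≤ n := by
      omega
    simp only [e1, e2]
    have : 0 < ε ^ 2 := by positivity
    linarith
  · have hs : Summable fun j : ℤ => (√(P j) - √(joinAt m g g' j)) ^ 2 := by
      refine Summable.of_nonneg_of_le (fun j => sq_nonneg _) (fun j => ?_) (hPs.add hsum)
      refine (sqrt_sub_sqrt_sq_le_abs (hP.1 j) (hnn j)).trans ?_
      have := hP.1 j
      have := hnn j
      rw [abs_le]
      constructor <;> linarith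
    rw [hellinger, Real.sqrt_le_left hε.le, tsum_int_eq_add hs m]
    simp only [joinAt_add, joinAt_sub]
    have : 0 < ε ^ 2 := by positivity
    linarith

end Integers

/-- Piecewise-affine approximation of discrete log-concave distributions in Hellinger
distance, with `O(1/√ε)` pieces; one may require the approximation to lie below `P` on its
support interval, or above `P` there. -/
theorem logconcave_piecewise_affine_approx :
    ∃ C : ℝ, 0 < C ∧
      ∀ P : ℤ → ℝ, IsDistr P → IsLogConcave P → ∀ ε : ℝ, 0 < ε → ε < 1 →
        (∃ a b : ℤ, a ≤ b ∧ ∃ g : ℤ → ℝ, GoodApprox C P ε g a b ∧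
          ∀ j : ℤ, a ≤ j → j ≤ b → g j ≤ P j) ∧
        (∃ a b : ℤ, a ≤ b ∧ ∃ g : ℤ → ℝ, GoodApprox C P ε g a b ∧
          ∀ j : ℤ, a ≤ j → j ≤ b → P j ≤ g j) := by
  refine ⟨2000000, by norm_num, fun P hP hlc ε hε hε1 => ?_⟩
  obtain ⟨m, hm, hmax⟩ := exists_mode hP
  have hη : 0 < √ε / 10000 := div_pos (Real.sqrt_pos.2 hε) (by norm_num)
  have hη1 : √ε / 10000 < 1 := by
    have : √ε ≤ 1 := Real.sqrt_le_one.2 hε1.le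
    linarith
  have hmass : ∀ f : ℕ → ℤ, f.Injective → ∀ n, ∑ j ∈ Finset.range n, P (f j) ≤ 1 := by
    intro f hf n
    rw [← Finset.sum_image (s := Finset.range n) (f := P) (hf.injOn)]
    exact sum_le_hasSum _ (fun j _ => hP.1 j) hP.2
  have haL : Antitone fun n : ℕ => P (m - 1 - n) := by
    have h := hlc.comp_neg.antitone_right (m := -m) (fun j => hP.1 _) (by simpa using hm)
      (by simpa using fun j => hmax (-j))
    intro i j hij
    have e : ∀ n : ℕ, m - 1 - n = -(-m + (n + 1 : ℕ)) := fun n => by push_cast; ring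
    simpa only [e] using h (Nat.succ_le_succ hij)
  obtain ⟨B, hB, g, G, hg, hG, hgG⟩ := exists_halfApprox (q := fun n : ℕ => P (m + n))
    (fun n => hP.1 _) (hlc.antitone_right hP.1 hm hmax)
    (fun n => by
      have h := hlc.2 (m + (n + 1 : ℕ))
      rwa [show m + ((n + 1 : ℕ) : ℤ) - 1 = m + n by push_cast; ring,
        show m + ((n + 1 : ℕ) : ℤ) + 1 = m + (n + 2 : ℕ) by push_cast; ring] at h)
    (hmass (fun n => m + n) fun a b h => by simpa using h) hη hη1
  obtain ⟨B', -, g', G', hg', hG', hgG'⟩ := exists_halfApprox (q := fun n : ℕ => P (m - 1 - n))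
    (fun n => hP.1 _) haL
    (fun n => by
      have h := hlc.2 (m - 1 - (n + 1 : ℕ))
      rwa [show m - 1 - ((n + 1 : ℕ) : ℤ) - 1 = m - 1 - (n + 2 : ℕ) by push_cast; ring,
        show m - 1 - ((n + 1 : ℕ) : ℤ) + 1 = m - 1 - n by push_cast; ring, mul_comm] at h)
    (hmass (fun n => m - 1 - n) fun a b h => by simpa using h) hη hη1
  have hB1 : 1 ≤ B := hB (by simpa using hm)
  refine ⟨⟨_, _, by omega, _, goodApprox_joinAt hP hε rfl hg hg', fun j hj1 hj2 => ?_⟩,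
    ⟨_, _, by omega, _, goodApprox_joinAt hP hε rfl hG hG', fun j hj1 hj2 => ?_⟩⟩ <;>
  rcases eq_add_or_eq_sub m j with ⟨n, rfl⟩ | ⟨n, rfl⟩
  · rw [joinAt_add]
    exact (hgG n (by omega)).1
  · rw [joinAt_sub]
    exact (hgG' n (by omega)).1
  · rw [joinAt_add]
    exact (hgG n (by omega)).2
  · rw [joinAt_sub]
    exact (hgG' n (by omega)).2

end Stmt18
end
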